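/- arXiv:1904.12202 — 3 statements merged into one kernel-verified Lean document; each statement's English description precedes it below -/
import Mathlib

section
/- Let n ≥ 3 and 0 ≤ i ≤ n−2. (1) For every a ∈ A_i there exist w ∈ C_n and k ≥ 1 such that w·[a] = (x_n q_i)^k in C_n, where [a] denotes the image of the word a in C_n. (2) For every b ∈ B_i there exist w ∈ C_n and k ≥ 1 such that [b]·w = (x_n q_i)^k in C_n. -/
namespace HK

/-- The generator `x_k` of the free monoid on `ZMod n` (indices taken mod `n`,
so `x_n` is the letter `0`). -/
def fx (n k : ℕ) : FreeMonoid (ZMod n) := FreeMonoid.of (k : ZMod n)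

/-- The ascending word `x_a x_{a+1} ⋯ x_b` (empty if `b < a`). -/
def asc (n a b : ℕ) : FreeMonoid (ZMod n) :=
  FreeMonoid.ofList ((List.range' a (b + 1 - a)).map fun k => (k : ZMod n))

/-- The descending word `x_a x_{a-1} ⋯ x_b` (empty if `a < b`). -/
def desc (n a b : ℕ) : FreeMonoid (ZMod n) :=
  FreeMonoid.ofList (((List.range' b (a + 1 - b)).map fun k => (k : ZMod n)).reverse)

/-- `x_a ⋯ x_b`: ascending if `a ≤ b`, descending otherwise. -/
def seg (n a b : ℕ) : FreeMonoid (ZMod n) := if a ≤ b then asc n a b else desc n a b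

/-- The word `q_i = x_1 ⋯ x_i x_{n-1} x_{n-2} ⋯ x_{i+1}`. -/
def qw (n i : ℕ) : FreeMonoid (ZMod n) := asc n 1 i * desc n (n - 1) (i + 1)

/-- `|u|_c`: the number of occurrences of the letter `c` in the word `u`. -/
def cnt (n : ℕ) (u : FreeMonoid (ZMod n)) (c : ZMod n) : ℕ :=
  (FreeMonoid.toList u).count c

/-- `w` is a factor of `v`. -/
def IsFactor {α : Type*} (w v : FreeMonoid α) : Prop := ∃ v₁ v₂, v = v₁ * w * v₂

/-- A word is reduced if it contains no factor of the forms (1)–(5). -/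
def Reduced (n : ℕ) (w : FreeMonoid (ZMod n)) : Prop :=
  (∀ i : ℕ, 1 ≤ i → i ≤ n → ¬ IsFactor (fx n i * fx n i) w) ∧
  (∀ i j : ℕ, 1 ≤ i → j ≤ n → 1 < j - i → j - i < n - 1 →
      ¬ IsFactor (fx n j * fx n i) w) ∧
  (∀ i j : ℕ, 1 ≤ i → i + 1 < j → j < n - 1 →
      ¬ IsFactor (fx n n * asc n 1 i * fx n j) w) ∧
  (∀ i : ℕ, ∀ u : FreeMonoid (ZMod n), 1 ≤ i → i ≤ n → u ≠ 1 →
      cnt n u (i : ZMod n) = 0 → cnt n u ((i : ZMod n) - 1) = 0 →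
      ¬ IsFactor (fx n i * u * fx n i) w) ∧
  (∀ i : ℕ, ∀ u : FreeMonoid (ZMod n), 1 ≤ i → i ≤ n → u ≠ 1 →
      cnt n u (i : ZMod n) = 0 → cnt n u ((i : ZMod n) + 1) = 0 →
      ¬ IsFactor (fx n i * u * fx n i) w)

/-- Membership in the set `A_i`. -/
def InA (n i : ℕ) (a : FreeMonoid (ZMod n)) : Prop :=
  ∃ (s : ℕ) (k : ℕ → ℕ),
    s ≤ i + 1 ∧
    (1 ≤ s → 1 ≤ k s ∧ k s ≤ s) ∧
    (∀ t, s + 1 ≤ t → t ≤ i + 1 → t < k t ∧ k t ≤ n - 1) ∧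
    (∀ t, s + 1 ≤ t → t + 1 ≤ i + 1 → k t < k (t + 1)) ∧
    ∃ p : FreeMonoid (ZMod n),
      p * a = (if s = 0 then 1 else seg n (k s) s) *
        ((List.range' (s + 1) (i + 1 - s)).map fun t => seg n (k t) t).prod

/-- Membership in the set `B_i`. -/
def InB (n i : ℕ) (b : FreeMonoid (ZMod n)) : Prop :=
  ∃ (r : ℕ) (I J : ℕ → ℕ),
    (∀ t, 1 ≤ t → t ≤ r → 1 ≤ I t ∧ I t < i + 1) ∧
    (∀ t, 1 ≤ t → t + 1 ≤ r → I (t + 1) < I t) ∧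
    i + 1 < J 1 ∧
    (∀ t, 1 ≤ t → t + 1 ≤ r + 1 → J t < J (t + 1)) ∧
    J (r + 1) ≤ n ∧
    ∃ p : FreeMonoid (ZMod n),
      b * p = ((List.range' 1 r).map fun t =>
          fx n n * asc n 1 (I t) * desc n (n - 1) (J t)).prod *
        (fx n n * desc n (n - 1) (J (r + 1)))

/-- The defining relations of the Hecke–Kiselman monoid of the oriented cycle. -/
def cnRel (n : ℕ) : FreeMonoid (ZMod n) → FreeMonoid (ZMod n) → Prop := fun w v =>
  (∃ a : ZMod n, w = FreeMonoid.of a * FreeMonoid.of a ∧ v = FreeMonoid.of a) ∨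
  (∃ a b : ZMod n, b ≠ a + 1 ∧ a ≠ b + 1 ∧
    w = FreeMonoid.of a * FreeMonoid.of b ∧ v = FreeMonoid.of b * FreeMonoid.of a) ∨
  (∃ a : ZMod n,
    (w = FreeMonoid.of a * FreeMonoid.of (a + 1) * FreeMonoid.of a ∨
     w = FreeMonoid.of (a + 1) * FreeMonoid.of a * FreeMonoid.of (a + 1)) ∧
    v = FreeMonoid.of a * FreeMonoid.of (a + 1))

/-- The Hecke–Kiselman monoid `C_n` of the oriented cycle of length `n`. -/
abbrev Cn (n : ℕ) := (conGen (cnRel n)).Quotient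

/-- The canonical projection `F → C_n`. -/
def pr (n : ℕ) : FreeMonoid (ZMod n) →* Cn n := (conGen (cnRel n)).mk'

/-- The ideal `I_i` of `C_n`. -/
def Iset (n i : ℕ) : Set (Cn n) :=
  {w | ¬ ∃ (u v : Cn n) (k : ℕ), 1 ≤ k ∧ u * w * v = (pr n (fx n n * qw n i)) ^ k}


/-! ### Auxiliary lemmas -/

/-- image of the letter -/
def X (n l : ℕ) : Cn n := pr n (fx n l)

theorem X_comm (n a b : ℕ) (h1 : a + 2 ≤ b) (h2 : b + 2 ≤ a + n) :
    Commute (X n a) (X n b) := by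
  have key : ∀ d : ℕ, 0 < d → d < n → ((d : ℕ) : ZMod n) ≠ 0 := by
    intro d hd hdn h
    rw [ZMod.natCast_eq_zero_iff] at h
    exact absurd (Nat.le_of_dvd hd h) (by omega)
  have e1 : (b : ZMod n) ≠ (a : ZMod n) + 1 := by
    intro h
    apply key (b - (a + 1)) (by omega) (by omega)
    rw [Nat.cast_sub (by omega)]
    push_cast
    rw [h, sub_self]
  have e2 : (a : ZMod n) ≠ (b : ZMod n) + 1 := by
    intro h
    apply key (b + 1 - a) (by omega) (by omega)
    rw [Nat.cast_sub (by omega)]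
    push_cast
    rw [← h, sub_self]
  unfold Commute SemiconjBy X pr
  rw [← map_mul, ← map_mul]
  refine (Con.eq _).2 (ConGen.Rel.of _ _ ?_)
  exact Or.inr (Or.inl ⟨_, _, e1, e2, rfl, rfl⟩)

theorem X_comm' (n a b : ℕ) (h : (a + 2 ≤ b ∧ b + 2 ≤ a + n) ∨ (b + 2 ≤ a ∧ a + 2 ≤ b + n)) :
    Commute (X n a) (X n b) := by
  rcases h with h | h
  · exact X_comm n a b h.1 h.2
  · exact (X_comm n b a h.1 h.2).symm

/-- image of ascending word -/
def pA (n a b : ℕ) : Cn n := pr n (asc n a b)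
/-- image of descending word -/
def pD (n a b : ℕ) : Cn n := pr n (desc n a b)

theorem ofList_comm (n : ℕ) (L : List (ZMod n)) (z : Cn n)
    (h : ∀ l ∈ L, Commute (pr n (FreeMonoid.of l)) z) :
    Commute (pr n (FreeMonoid.ofList L)) z := by
  induction L with
  | nil => simp
  | cons x L ih =>
    rw [FreeMonoid.ofList_cons, map_mul]
    exact (h x (by simp)).mul_left (ih fun l hl => h l (by simp [hl]))

theorem bind_cast (n : ℕ) (L : List ℕ) :
    (do let a ← L; pure (a : ZMod n) : List (ZMod n)) = L.map (fun k : ℕ => (k : ZMod n)) := by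
  induction L with
  | nil => rfl
  | cons x L ih => simp_all

theorem asc_eq (n a b : ℕ) : asc n a b =
    FreeMonoid.ofList ((List.range' a (b + 1 - a)).map fun k : ℕ => (k : ZMod n)) := by
  unfold asc
  rw [bind_cast, List.map_id'']
  intro x
  rfl

theorem desc_eq (n a b : ℕ) : desc n a b =
    FreeMonoid.ofList ((List.range' b (a + 1 - b)).map fun k : ℕ => (k : ZMod n)).reverse := by
  unfold desc
  rw [bind_cast, List.map_id'']
  intro x
  rfl

theorem pA_comm (n a b : ℕ) (z : Cn n) (h : ∀ l, a ≤ l → l ≤ b → Commute (X n l) z) :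
    Commute (pA n a b) z := by
  unfold pA
  rw [asc_eq]
  apply ofList_comm
  intro l hl
  simp only [List.mem_map, List.mem_range'_1] at hl
  obtain ⟨k, hk, rfl⟩ := hl
  exact h k (by omega) (by omega)

theorem pD_comm (n a b : ℕ) (z : Cn n) (h : ∀ l, b ≤ l → l ≤ a → Commute (X n l) z) :
    Commute (pD n a b) z := by
  unfold pD
  rw [desc_eq]
  apply ofList_comm
  intro l hl
  simp only [List.mem_reverse, List.mem_map, List.mem_range'_1] at hl
  obtain ⟨k, hk, rfl⟩ := hl
  exact h k (by omega) (by omega)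

theorem pA_split (n a b c : ℕ) (h1 : a ≤ c + 1) (h2 : c ≤ b) :
    pA n a b = pA n a c * pA n (c + 1) b := by
  unfold pA
  simp only [asc_eq]
  rw [← map_mul, ← FreeMonoid.ofList_append, ← List.map_append]
  congr 3
  obtain ⟨p, rfl⟩ : ∃ p, b = c + p := ⟨b - c, by omega⟩
  obtain ⟨q, hq⟩ : ∃ q, c + 1 = a + q := ⟨c + 1 - a, by omega⟩
  rw [show c + p + 1 - a = q + p by omega, show c + 1 - a = q by omega,
    show c + p + 1 - (c + 1) = p by omega, hq, List.range'_append_1]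

theorem pD_split (n a b c : ℕ) (h1 : b ≤ c + 1) (h2 : c ≤ a) :
    pD n a b = pD n a (c + 1) * pD n c b := by
  unfold pD
  simp only [desc_eq]
  rw [← map_mul, ← FreeMonoid.ofList_append, ← List.reverse_append, ← List.map_append]
  congr 4
  obtain ⟨p, rfl⟩ : ∃ p, a = c + p := ⟨a - c, by omega⟩
  obtain ⟨q, hq⟩ : ∃ q, c + 1 = b + q := ⟨c + 1 - b, by omega⟩
  rw [show c + p + 1 - b = q + p by omega, show c + 1 - b = q by omega,
    show c + p + 1 - (c + 1) = p by omega, hq, List.range'_append_1]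

theorem pA_empty (n a b : ℕ) (h : b < a) : pA n a b = 1 := by
  unfold pA
  simp only [asc_eq]
  rw [show b + 1 - a = 0 by omega]
  simp

theorem pD_empty (n a b : ℕ) (h : a < b) : pD n a b = 1 := by
  unfold pD
  simp only [desc_eq]
  rw [show a + 1 - b = 0 by omega]
  simp

theorem pA_self (n a : ℕ) : pA n a a = X n a := by
  unfold pA X fx
  simp only [asc_eq]
  rw [show a + 1 - a = 1 by omega]
  simp

theorem pD_self (n a : ℕ) : pD n a a = X n a := by
  unfold pD X fx
  simp only [desc_eq]
  rw [show a + 1 - a = 1 by omega]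
  simp

/-- commutation of a descending block with the later ascending one -/
theorem pD_pA_comm (n d e a b : ℕ) (ha : 1 ≤ a) (hd : d ≤ n - 1) (h : b + 2 ≤ e) (hn : 3 ≤ n) :
    Commute (pD n d e) (pA n a b) := by
  apply pD_comm
  intro l h1 h2
  apply Commute.symm
  apply pA_comm
  intro p h3 h4
  exact X_comm _ _ _ (by omega) (by omega)

/-- `Q = x_n q_i`. -/
def Q (n i : ℕ) : Cn n := pr n (fx n n * qw n i)

theorem Q_eq (n i : ℕ) : Q n i = X n n * (pA n 1 i * pD n (n - 1) (i + 1)) := by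
  simp [Q, qw, X, pA, pD]

/-! ### Part B -/

theorem partB (n i m : ℕ) (I J : ℕ → ℕ) (hn : 3 ≤ n) (hi : i ≤ n - 2)
    (hI : ∀ t, 1 ≤ t → t ≤ m → I t ≤ i)
    (hJ : ∀ t, 1 ≤ t → t ≤ m → i + 1 < J t ∧ J t ≤ n)
    (hIm : ∀ s t, 1 ≤ s → s < t → t ≤ m → I t < I s)
    (hJm : ∀ s t, 1 ≤ s → s < t → t ≤ m → J s < J t) :
    ∃ w : Cn n, ((List.range' 1 m).map fun t =>
      X n n * pA n 1 (I t) * pD n (n - 1) (J t)).prod * w = Q n i ^ m ∧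
      ∀ z, (∀ t, 1 ≤ t → t ≤ m → ∀ l, I t + 1 ≤ l → l + 1 ≤ J t → Commute (X n l) z) →
        Commute w z := by
  induction m with
  | zero => exact ⟨(1 : Cn n), by simp, fun z _ => Commute.one_left z⟩
  | succ m ih =>
    obtain ⟨w, hw, hc⟩ := ih (fun t h1 h2 => hI t h1 (by omega)) (fun t h1 h2 => hJ t h1 (by omega))
      (fun s t h1 h2 h3 => hIm s t h1 h2 (by omega)) (fun s t h1 h2 h3 => hJm s t h1 h2 (by omega))
    have hI1 := hI (m + 1) (by omega) le_rfl
    obtain ⟨hJ1, hJ2⟩ := hJ (m + 1) (by omega) le_rfl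
    refine ⟨w * (pA n (I (m + 1) + 1) i * pD n (J (m + 1) - 1) (i + 1)), ?_, ?_⟩
    · have hcomm : Commute w (X n n * pA n 1 (I (m + 1)) * pD n (n - 1) (J (m + 1))) := by
        apply hc
        intro t h1 h2 l h3 h4
        have a1 := hIm t (m + 1) h1 (by omega) le_rfl
        have a2 := hJm t (m + 1) h1 (by omega) le_rfl
        refine Commute.mul_right (Commute.mul_right ?_ ?_) ?_
        · exact X_comm' _ _ _ (by omega)
        · apply Commute.symm
          apply pA_comm
          intro p _ _
          exact X_comm' _ _ _ (by omega)
        · apply Commute.symm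
          apply pD_comm
          intro p _ _
          exact X_comm' _ _ _ (by omega)
      have hq : Q n i = (X n n * pA n 1 (I (m + 1)) * pD n (n - 1) (J (m + 1))) *
          (pA n (I (m + 1) + 1) i * pD n (J (m + 1) - 1) (i + 1)) := by
        rw [Q_eq, pA_split n 1 i (I (m + 1)) (by omega) hI1,
          pD_split n (n - 1) (i + 1) (J (m + 1) - 1) (by omega) (by omega),
          show J (m + 1) - 1 + 1 = J (m + 1) by omega]
        have := pD_pA_comm n (n - 1) (J (m + 1)) (I (m + 1) + 1) i (by omega) le_rfl (by omega) hn
        simp only [mul_assoc]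
        rw [← mul_assoc (pD n (n - 1) (J (m + 1))), this.eq]
        simp only [mul_assoc]
      rw [List.range'_1_concat, List.map_append, List.prod_append, pow_succ, ← hw]
      conv_rhs => rw [hq]
      simp only [List.map_cons, List.map_nil, List.prod_cons, List.prod_nil, mul_one]
      rw [show 1 + m = m + 1 by omega]
      generalize X n n * pA n 1 (I (m + 1)) * pD n (n - 1) (J (m + 1)) = D at *
      generalize pA n (I (m + 1) + 1) i * pD n (J (m + 1) - 1) (i + 1) = C at *
      rw [mul_assoc, ← mul_assoc D, ← hcomm.eq]
      simp only [mul_assoc]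
    · intro z hz
      refine Commute.mul_left (hc z fun t h1 h2 => hz t h1 (by omega)) (Commute.mul_left ?_ ?_)
      · apply pA_comm
        intro l _ _
        exact hz (m + 1) (by omega) le_rfl l (by omega) (by omega)
      · apply pD_comm
        intro l _ _
        exact hz (m + 1) (by omega) le_rfl l (by omega) (by omega)

theorem lt_chain (f : ℕ → ℕ) (a b : ℕ) (h : ∀ t, a ≤ t → t + 1 ≤ b → f t < f (t + 1)) :
    ∀ s t, a ≤ s → s < t → t ≤ b → f s < f t := by
  intro s t hs hst
  induction t, hst using Nat.le_induction with
  | base => intro hb; exact h s hs hb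
  | succ t ht ih =>
    intro hb
    exact (ih (by omega)).trans (h t (by simp at ht; omega) hb)

theorem gt_chain (f : ℕ → ℕ) (a b : ℕ) (h : ∀ t, a ≤ t → t + 1 ≤ b → f (t + 1) < f t) :
    ∀ s t, a ≤ s → s < t → t ≤ b → f t < f s := by
  intro s t hs hst
  induction t, hst using Nat.le_induction with
  | base => intro hb; exact h s hs hb
  | succ t ht ih =>
    intro hb
    exact (h t (by simp at ht; omega) hb).trans (ih (by omega))

theorem mainB (n i : ℕ) (hn : 3 ≤ n) (hi : i ≤ n - 2) (b : FreeMonoid (ZMod n)) (hb : InB n i b) :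
    ∃ (w : Cn n) (k : ℕ), 1 ≤ k ∧ pr n b * w = (Q n i) ^ k := by
  obtain ⟨r, I, J, h1, h2, h3, h4, h5, p, hp⟩ := hb
  have hJm := lt_chain J 1 (r + 1) h4
  have hIm := gt_chain I 1 r h2
  obtain ⟨w, hw, -⟩ := partB n i (r + 1) (fun t => if t = r + 1 then 0 else I t) J hn hi
    (by
      intro t ht1 ht2
      split_ifs with h
      · omega
      · have := (h1 t ht1 (by omega)).2
        omega)
    (by
      intro t ht1 ht2
      constructor
      · rcases Nat.eq_or_lt_of_le ht1 with h | h
        · rw [← h]; exact h3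
        · exact h3.trans (hJm 1 t le_rfl h ht2)
      · rcases Nat.eq_or_lt_of_le ht2 with h | h
        · rw [h]; exact h5
        · exact (hJm t (r + 1) ht1 h le_rfl).le.trans h5)
    (by
      intro s t hs hst ht
      rw [if_neg (show s ≠ r + 1 by omega)]
      split_ifs with h
      · exact (h1 s hs (by omega)).1
      · exact hIm s t hs hst (by omega))
    hJm
  refine ⟨pr n p * w, r + 1, by omega, ?_⟩
  rw [← mul_assoc, ← map_mul, hp, ← hw]
  congr 1
  rw [List.range'_1_concat, List.map_append, List.prod_append, map_mul, map_list_prod,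
    List.map_map]
  congr 1
  · congr 1
    apply List.map_congr_left
    intro t ht
    rw [List.mem_range'_1] at ht
    simp only [Function.comp]
    rw [if_neg (by omega)]
    simp [X, pA, pD]
  · rw [show 1 + r = r + 1 by omega]
    simp only [List.map_cons, List.map_nil, List.prod_cons, List.prod_nil, mul_one, if_true]
    rw [pA_empty n 1 0 (by omega)]
    simp [X, pD]

/-! ### Part A -/

/-- product of descending blocks -/
def W (n s m : ℕ) (k : ℕ → ℕ) (e : ℕ) : Cn n :=
  ((List.range' (s + 1) m).map fun t => pD n (k t) (t + e)).prod

theorem W_succ (n s m : ℕ) (k : ℕ → ℕ) (e : ℕ) :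
    W n s (m + 1) k e = W n s m k e * pD n (k (s + 1 + m)) (s + 1 + m + e) := by
  unfold W
  rw [List.range'_1_concat, List.map_append, List.prod_append]
  simp

theorem W_cons (n s m : ℕ) (k : ℕ → ℕ) (e : ℕ) :
    W n s (m + 1) k e = pD n (k (s + 1)) (s + 1 + e) * W n (s + 1) m k e := by
  unfold W
  rw [List.range'_succ]
  simp

theorem W_shift (n s m : ℕ) (k : ℕ → ℕ) :
    W n s m k 1 = W n (s + 1) m (fun t => k (t - 1)) 0 := by
  induction m with
  | zero => simp [W]
  | succ m ih =>
    rw [W_succ, W_succ, ih]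
    congr 2
    · congr 1; omega
    · omega

theorem W_comm (n s m : ℕ) (k : ℕ → ℕ) (e : ℕ) (z : Cn n)
    (h : ∀ t, s + 1 ≤ t → t ≤ s + m → ∀ l, t + e ≤ l → l ≤ k t → Commute (X n l) z) :
    Commute (W n s m k e) z := by
  induction m with
  | zero => simp [W]
  | succ m ih =>
    rw [W_succ]
    refine Commute.mul_left (ih fun t h1 h2 => h t h1 (by omega)) ?_
    apply pD_comm
    intro l h1 h2
    exact h (s + 1 + m) (by omega) (by omega) l h1 h2

theorem W_rearr (n s m : ℕ) (k : ℕ → ℕ) (hn : 3 ≤ n)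
    (h : ∀ t, s + 1 ≤ t → t ≤ s + m → t ≤ k t ∧ k t ≤ n - 1) :
    W n s m k 0 = W n s m k 1 * pA n (s + 1) (s + m) := by
  induction m with
  | zero => simp [W, pA_empty]
  | succ m ih =>
    obtain ⟨a1, a2⟩ := h (s + 1 + m) (by omega) (by omega)
    rw [W_succ, W_succ, ih fun t h1 h2 => h t h1 (by omega),
      pD_split n (k (s + 1 + m)) (s + 1 + m + 0) (s + 1 + m) (by omega) a1,
      pA_split n (s + 1) (s + (m + 1)) (s + m) (by omega) (by omega),
      show s + (m + 1) = s + m + 1 by omega, pA_self,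
      show s + 1 + m + 0 = s + 1 + m by omega, pD_self, show s + 1 + m = s + m + 1 by omega]
    rw [show s + 1 + m = s + m + 1 by omega] at a2
    have := pD_pA_comm n (k (s + m + 1)) (s + m + 1 + 1) (s + 1) (s + m) (by omega) a2 (by omega) hn
    simp only [mul_assoc]
    rw [← mul_assoc (pA n (s + 1) (s + m)), ← this.eq]
    simp only [mul_assoc]

theorem stepA (n i s m a N : ℕ) (k : ℕ → ℕ) (w' : Cn n) (hn : 3 ≤ n) (hi : i ≤ n - 2)
    (hsm : s + m = i) (ha : 1 ≤ a) (has : a ≤ s + 1)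
    (hk : ∀ t, s + 1 ≤ t → t ≤ i + 1 → t ≤ k t) (hK : k (i + 1) ≤ n - 1)
    (hm : ∀ t, s + 1 ≤ t → t + 1 ≤ i + 1 → k t < k (t + 1))
    (hw : w' * W n s m k 1 = Q n i ^ N) :
    ∃ w, w * (pA n a s * W n s (m + 1) k 0) = Q n i ^ (N + 1) := by
  have hm' := lt_chain k (s + 1) (i + 1) hm
  have hlt : ∀ t, s + 1 ≤ t → t ≤ i → k t < k (i + 1) := fun t h1 h2 =>
    hm' t (i + 1) h1 (by omega) le_rfl
  have hKi := hk (i + 1) (by omega) le_rfl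
  refine ⟨w' * (X n n * pA n 1 (a - 1) * pD n (n - 1) (k (i + 1) + 1)), ?_⟩
  have e1 : W n s (m + 1) k 0 = W n s m k 1 * pA n (s + 1) i * pD n (k (i + 1)) (i + 1) := by
    rw [W_succ, W_rearr n s m k hn]
    · rw [hsm, show s + 1 + m + 0 = i + 1 by omega, show s + 1 + m = i + 1 by omega]
    · intro t h1 h2
      have := hlt t h1 (by omega)
      exact ⟨hk t h1 (by omega), by omega⟩
  have e2 : Q n i = X n n * pA n 1 (a - 1) * (pA n a s * pA n (s + 1) i) *
      (pD n (n - 1) (k (i + 1) + 1) * pD n (k (i + 1)) (i + 1)) := by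
    rw [Q_eq, pD_split n (n - 1) (i + 1) (k (i + 1)) (by omega) hK,
      pA_split n 1 i (a - 1) (by omega) (by omega), show a - 1 + 1 = a by omega,
      pA_split n a i s (by omega) (by omega)]
    simp only [mul_assoc]
  have c1 : Commute (W n s m k 1)
      (X n n * pA n 1 (a - 1) * pD n (n - 1) (k (i + 1) + 1) * pA n a s) := by
    apply W_comm
    intro t h1 h2 l h3 h4
    have := hlt t h1 (by omega)
    refine Commute.mul_right (Commute.mul_right (Commute.mul_right ?_ ?_) ?_) ?_
    · exact X_comm' _ _ _ (by omega)
    · apply Commute.symm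
      apply pA_comm
      intro p _ _
      exact X_comm' _ _ _ (by omega)
    · apply Commute.symm
      apply pD_comm
      intro p _ _
      exact X_comm' _ _ _ (by omega)
    · apply Commute.symm
      apply pA_comm
      intro p _ _
      exact X_comm' _ _ _ (by omega)
  have c2 : Commute (pD n (n - 1) (k (i + 1) + 1)) (pA n a s * pA n (s + 1) i) :=
    Commute.mul_right (pD_pA_comm _ _ _ _ _ ha le_rfl (by omega) hn)
      (pD_pA_comm _ _ _ _ _ (by omega) le_rfl (by omega) hn)
  rw [pow_succ, ← hw, e1]
  conv_rhs => rw [e2]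
  generalize W n s m k 1 = P at *
  generalize X n n * pA n 1 (a - 1) = x at *
  generalize pD n (n - 1) (k (i + 1) + 1) = d at *
  generalize pA n a s = a2 at *
  generalize pA n (s + 1) i = a3 at *
  generalize pD n (k (i + 1)) (i + 1) = d2 at *
  calc w' * (x * d) * (a2 * (P * a3 * d2)) = w' * ((x * d * a2) * P) * (a3 * d2) := by
        simp only [mul_assoc]
    _ = w' * (P * (x * d * a2)) * (a3 * d2) := by rw [c1.eq]
    _ = w' * P * x * (d * (a2 * a3)) * d2 := by simp only [mul_assoc]
    _ = w' * P * x * ((a2 * a3) * d) * d2 := by rw [c2.eq]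
    _ = _ := by simp only [mul_assoc]

theorem partA (n i : ℕ) (hn : 3 ≤ n) (hi : i ≤ n - 2) (m : ℕ) : ∀ (s : ℕ) (k : ℕ → ℕ),
    s + m = i + 1 → k (i + 1) ≤ n - 1 →
    (∀ t, s + 1 ≤ t → t + 1 ≤ i + 1 → k t < k (t + 1)) →
    ∃ (w : Cn n) (N : ℕ), w * W n s m k 0 = Q n i ^ N := by
  induction m with
  | zero => intro s k _ _ _; exact ⟨1, 0, by simp [W]⟩
  | succ m ih =>
    intro s k hsm hK hm
    by_cases h : k (s + 1) ≤ s
    · obtain ⟨w, N, hw⟩ := ih (s + 1) k (by omega) hK (fun t h1 h2 => hm t (by omega) h2)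
      refine ⟨w, N, ?_⟩
      rw [W_cons, pD_empty _ _ _ (by omega), one_mul, hw]
    · have hk : ∀ t, s + 1 ≤ t → t ≤ i + 1 → t ≤ k t := by
        intro t ht
        induction t, ht using Nat.le_induction with
        | base => intro _; omega
        | succ t ht ih2 =>
          intro h2
          have := ih2 (by omega)
          have := hm t ht h2
          omega
      obtain ⟨w', N, hw'⟩ : ∃ (w : Cn n) (N : ℕ), w * W n s m k 1 = Q n i ^ N := by
        rw [W_shift]
        by_cases hm0 : m = 0
        · subst hm0
          exact ⟨1, 0, by simp [W]⟩
        apply ih (s + 1) _ (by omega)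
        · have := hm i (by omega) (by omega)
          simp only [Nat.add_sub_cancel]
          omega
        · intro t h1 h2
          have := hm (t - 1) (by omega) (by omega)
          rw [show t - 1 + 1 = t by omega] at this
          simpa using this
      obtain ⟨w, hw⟩ := stepA n i s m (s + 1) N k w' hn hi (by omega) (by omega) le_rfl hk hK hm hw'
      refine ⟨w, N + 1, ?_⟩
      rw [pA_empty _ _ _ (by omega), one_mul] at hw
      exact hw

theorem partA' (n i s a : ℕ) (k : ℕ → ℕ) (hn : 3 ≤ n) (hi : i ≤ n - 2) (hs : s ≤ i + 1)
    (ha : 1 ≤ a) (has : a ≤ s + 1)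
    (hk : ∀ t, s + 1 ≤ t → t ≤ i + 1 → t ≤ k t ∧ k t ≤ n - 1)
    (hm : ∀ t, s + 1 ≤ t → t + 1 ≤ i + 1 → k t < k (t + 1)) :
    ∃ (w : Cn n) (N : ℕ), w * (pA n a s * W n s (i + 1 - s) k 0) = Q n i ^ N := by
  rcases Nat.eq_or_lt_of_le hs with h | h
  · subst h
    have e : W n (i + 1) (i + 1 - (i + 1)) k 0 = 1 := by simp [W]
    rw [e, mul_one]
    by_cases h2 : a = i + 2
    · exact ⟨1, 0, by rw [pA_empty _ _ _ (by omega)]; simp⟩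
    refine ⟨X n n * pA n 1 (a - 1) * pD n (n - 1) (i + 1 + 1), 1, ?_⟩
    rw [pow_one, Q_eq, pD_split n (n - 1) (i + 1) (i + 1) (by omega) (by omega), pD_self,
      pA_split n 1 i (a - 1) (by omega) (by omega), show a - 1 + 1 = a by omega,
      pA_split n a (i + 1) i (by omega) (by omega), pA_self]
    have := pD_pA_comm n (n - 1) (i + 1 + 1) a i ha le_rfl (by omega) hn
    simp only [mul_assoc]
    rw [← mul_assoc (pD n (n - 1) (i + 1 + 1)), this.eq]
    simp only [mul_assoc]
  · obtain ⟨w', N, hw'⟩ : ∃ (w : Cn n) (N : ℕ), w * W n s (i - s) k 1 = Q n i ^ N := by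
      rw [W_shift]
      by_cases hm0 : i - s = 0
      · rw [hm0]
        exact ⟨1, 0, by simp [W]⟩
      apply partA n i hn hi _ (s + 1) _ (by omega)
      · simpa using (hk i (by omega) (by omega)).2
      · intro t h1 h2
        have := hm (t - 1) (by omega) (by omega)
        rw [show t - 1 + 1 = t by omega] at this
        simpa using this
    obtain ⟨w, hw⟩ := stepA n i s (i - s) a N k w' hn hi (by omega) ha has
      (fun t h1 h2 => (hk t h1 h2).1) (hk (i + 1) (by omega) le_rfl).2 hm hw'
    refine ⟨w, N + 1, ?_⟩
    rw [show i + 1 - s = i - s + 1 by omega]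
    exact hw

theorem mainA (n i : ℕ) (hn : 3 ≤ n) (hi : i ≤ n - 2) (a : FreeMonoid (ZMod n)) (h : InA n i a) :
    ∃ (w : Cn n) (k : ℕ), 1 ≤ k ∧ w * pr n a = (Q n i) ^ k := by
  obtain ⟨s, k, hs, h1, h2, h3, p, hp⟩ := h
  have hW : pr n ((List.range' (s + 1) (i + 1 - s)).map fun t => seg n (k t) t).prod =
      W n s (i + 1 - s) k 0 := by
    unfold W
    rw [map_list_prod, List.map_map]
    congr 1
    apply List.map_congr_left
    intro t ht
    rw [List.mem_range'_1] at ht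
    have := h2 t ht.1 (by omega)
    simp only [Function.comp, seg, pD, add_zero]
    rw [if_neg (by omega)]
  have key : ∃ (w : Cn n) (N : ℕ), w * pr n (p * a) = Q n i ^ N := by
    have hk : ∀ t, s + 1 ≤ t → t ≤ i + 1 → t ≤ k t ∧ k t ≤ n - 1 := fun t a1 a2 =>
      ⟨(h2 t a1 a2).1.le, (h2 t a1 a2).2⟩
    rw [hp, map_mul, hW]
    by_cases hs0 : s = 0
    · obtain ⟨w, N, hw⟩ := partA' n i s (s + 1) k hn hi hs (by omega) le_rfl hk h3
      rw [pA_empty _ _ _ (by omega)] at hw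
      exact ⟨w, N, by rw [if_pos hs0, map_one]; exact hw⟩
    · obtain ⟨b1, b2⟩ := h1 (by omega)
      obtain ⟨w, N, hw⟩ := partA' n i s (k s) k hn hi hs b1 (by omega) hk h3
      refine ⟨w, N, ?_⟩
      rw [if_neg hs0, seg, if_pos b2]
      exact hw
  obtain ⟨w, N, hw⟩ := key
  refine ⟨Q n i * w * pr n p, N + 1, by omega, ?_⟩
  rw [pow_succ', ← hw, map_mul]
  simp only [mul_assoc]

/-- Theorem 3.13 (tw2). -/
theorem stmt9 (n i : ℕ) (hn : 3 ≤ n) (hi : i ≤ n - 2) :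
    (∀ a : FreeMonoid (ZMod n), InA n i a →
      ∃ (w : Cn n) (k : ℕ), 1 ≤ k ∧ w * pr n a = (pr n (fx n n * qw n i)) ^ k) ∧
    (∀ b : FreeMonoid (ZMod n), InB n i b →
      ∃ (w : Cn n) (k : ℕ), 1 ≤ k ∧ pr n b * w = (pr n (fx n n * qw n i)) ^ k) := by
  exact ⟨fun a h => mainA n i hn hi a h, fun b h => mainB n i hn hi b h⟩

end HK
end

section
/- Let n ≥ 3 and 0 ≤ i ≤ n−2. For all a ∈ A_i, b ∈ B_i and k ≥ 1, the element [a] (x_n q_i)^k [b] of C_n lies in I_{i−1} and does not lie in I_i (where [·] denotes the image in C_n). -/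
namespace HK

/-- The ideal `I_{-1} = I_0 ∪ C_n (x_n q_0) C_n`. -/
def Im1 (n : ℕ) : Set (Cn n) :=
  Iset n 0 ∪ {w | ∃ u v : Cn n, w = u * pr n (fx n n * qw n 0) * v}

def step {n : ℕ} (a : ZMod n) (S : Set (ZMod n)) : Set (ZMod n) := insert (a - 1) (S \ {a})

def Hop {n : ℕ} : Set (ZMod n) → List (ZMod n) → Prop
  | _, [] => True
  | S, a :: l => a ∈ S ∧ a - 1 ∉ S ∧ Hop (step a S) l

def run {n : ℕ} : Set (ZMod n) → List (ZMod n) → Set (ZMod n)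
  | S, [] => S
  | S, a :: l => run (step a S) l

theorem hop_append {n : ℕ} (l l' : List (ZMod n)) : ∀ S : Set (ZMod n),
    Hop S (l ++ l') ↔ Hop S l ∧ Hop (run S l) l' := by
  induction l with
  | nil => intro S; simp [Hop, run]
  | cons a l ih => intro S; simp [Hop, run, ih, and_assoc]

theorem run_append {n : ℕ} (l l' : List (ZMod n)) : ∀ S : Set (ZMod n),
    run S (l ++ l') = run (run S l) l' := by
  induction l with
  | nil => intro S; simp [run]
  | cons a l ih => intro S; simp [run, ih]

theorem hop_erase {n : ℕ} {M : Type*} [Monoid M] (g : ZMod n → M)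
    (hg : ∀ a b : ZMod n, b ≠ a + 1 → a ≠ b + 1 → g a * g b = g b * g a)
    (a : ZMod n) (l : List (ZMod n)) : ∀ S : Set (ZMod n), Hop S l → a ∈ S → a - 1 ∉ S → a ∈ l →
      Hop (step a S) (l.erase a) ∧ g a * ((l.erase a).map g).prod = (l.map g).prod := by
  induction l with
  | nil => intro S _ _ _ h; simp at h
  | cons b l ih =>
    intro S hS ha ha1 hal
    obtain ⟨hb, hb1, hl⟩ := hS
    by_cases hab : b = a
    · subst hab
      simp [hl]
    · have hal' : a ∈ l := by
        rcases List.mem_cons.1 hal with h | h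
        · exact absurd h.symm hab
        · exact h
      have h1 : b ≠ a - 1 := fun h => ha1 (h ▸ hb)
      have h2 : b - 1 ≠ a := fun h => hb1 (h ▸ ha)
      have h3 : b - 1 ≠ a - 1 := fun h => hab (by simpa using h)
      obtain ⟨i1, i2⟩ := ih (step b S) hl (by simp [step, ha, Ne.symm hab])
        (by simp [step, ha1, Ne.symm h3]) hal'
      · have hc : step a (step b S) = step b (step a S) := by
          ext x
          simp only [step, Set.mem_insert_iff, Set.mem_sdiff, Set.mem_singleton_iff]
          have e1 : x = b - 1 → x ≠ a := fun h => h ▸ h2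
          have e2 : x = a - 1 → x ≠ b := fun h h' => h1 (h' ▸ h)
          tauto
        rw [List.erase_cons_tail (by simpa using hab)]
        refine ⟨⟨by simp [step, hb, hab], by simp [step, hb1, h3, hab], hc ▸ i1⟩, ?_⟩
        simp only [List.map_cons, List.prod_cons]
        rw [← i2, ← mul_assoc, ← mul_assoc, hg a b]
        · intro h; apply h2; rw [h]; ring
        · intro h; apply h1; rw [h]; ring

theorem hop_prefix {n : ℕ} {M : Type*} [Monoid M] (g : ZMod n → M)
    (hg : ∀ a b : ZMod n, b ≠ a + 1 → a ≠ b + 1 → g a * g b = g b * g a)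
    (l1 : List (ZMod n)) : ∀ (S : Set (ZMod n)) (l2 : List (ZMod n)), Hop S l1 → Hop S l2 →
      (∀ a, l1.count a ≤ l2.count a) → ∃ m : M, (l1.map g).prod * m = (l2.map g).prod := by
  induction l1 with
  | nil => intro S l2 _ _ _; exact ⟨(l2.map g).prod, by simp⟩
  | cons a l ih =>
    intro S l2 h1 h2 hc
    obtain ⟨ha, ha1, hl⟩ := h1
    have hmem : a ∈ l2 := by
      have := hc a
      rw [List.count_cons_self] at this
      exact List.count_pos_iff.1 (by omega)
    obtain ⟨e1, e2⟩ := hop_erase g hg a l2 S h2 ha ha1 hmem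
    obtain ⟨m, hm⟩ := ih (step a S) (l2.erase a) hl e1 (by
      intro b
      have := hc b
      rw [List.count_cons] at this
      rw [List.count_erase]
      simp only [beq_iff_eq] at *
      by_cases hab : a = b
      · simp [hab] at *; omega
      · simp [hab, Ne.symm hab] at *; omega)
    exact ⟨m, by rw [← e2, ← hm]; simp [mul_assoc]⟩

theorem hop_pow {n : ℕ} (S : Set (ZMod n)) (W : List (ZMod n)) (h : Hop S W) (hr : run S W = S)
    (N : ℕ) : Hop S (List.replicate N W).flatten := by
  induction N with
  | zero => simp [Hop]
  | succ N ih => rw [List.replicate_succ, List.flatten_cons, hop_append, hr]; exact ⟨h, ih⟩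

theorem hop_complete {n : ℕ} {M : Type*} [Monoid M] (g : ZMod n → M)
    (hg : ∀ a b : ZMod n, b ≠ a + 1 → a ≠ b + 1 → g a * g b = g b * g a)
    (S : Set (ZMod n)) (W l : List (ZMod n)) (h : Hop S W) (hr : run S W = S)
    (hW : ∀ a, a ∈ W) (hl : Hop S l) :
    ∃ (m : M) (N : ℕ), (l.map g).prod * m = (W.map g).prod ^ N := by
  obtain ⟨m, hm⟩ := hop_prefix g hg l S (List.replicate l.length W).flatten hl
    (hop_pow S W h hr _) (by
      intro a
      rw [List.count_flatten, List.map_replicate, List.sum_replicate, smul_eq_mul]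
      have h1 : 1 ≤ W.count a := List.count_pos_iff.2 (hW a)
      have h2 : l.count a ≤ l.length := List.count_le_length
      nlinarith)
  refine ⟨m, l.length, ?_⟩
  rw [hm, List.map_flatten, List.prod_flatten]
  simp

theorem cast_inj {n a b : ℕ} (ha : a < n) (hb : b < n) : ((a : ZMod n) = (b : ZMod n)) ↔ a = b := by
  constructor
  · intro h
    have := congrArg ZMod.val h
    rwa [ZMod.val_natCast_of_lt ha, ZMod.val_natCast_of_lt hb] at this
  · rintro rfl; rfl

def ups (n a m : ℕ) : List (ZMod n) := List.map (fun k : ℕ => (k : ZMod n)) (List.range' a m)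

theorem asc_list (n a b : ℕ) : FreeMonoid.toList (asc n a b) = ups n a (b + 1 - a) := by
  simp [asc, ups, ← List.map_eq_flatMap]

theorem desc_list (n a b : ℕ) : FreeMonoid.toList (desc n a b) = (ups n b (a + 1 - b)).reverse := by
  simp [desc, ups, ← List.map_eq_flatMap]

theorem hop_up {n : ℕ} (m : ℕ) : ∀ (a : ℕ) (S : Set (ZMod n)), a + m < n → (a : ZMod n) ∉ S →
    (∀ j, a < j → j ≤ a + m → (j : ZMod n) ∈ S) →
    Hop S (ups n (a + 1) m) ∧ run S (ups n (a + 1) m) = insert (a : ZMod n) S \ {((a + m : ℕ) : ZMod n)} := by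
  induction m with
  | zero => intro a S _ h _; simp [Hop, run, h, ups]
  | succ m ih =>
    intro a S hn h hj
    have e1 : (((a + 1 : ℕ) : ZMod n)) - 1 = a := by push_cast; ring
    have hs : step ((a + 1 : ℕ) : ZMod n) S = insert (a : ZMod n) (S \ {((a + 1 : ℕ) : ZMod n)}) := by
      rw [step, e1]
    have hne : ((a + 1 : ℕ) : ZMod n) ≠ (a : ZMod n) := by
      rw [Ne, cast_inj (by omega) (by omega)]; omega
    have h1 := hj (a + 1) (by omega) (by omega)
    obtain ⟨i1, i2⟩ := ih (a + 1) (step ((a + 1 : ℕ) : ZMod n) S) (by omega)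
      (by rw [hs]; simp only [Set.mem_insert_iff, Set.mem_sdiff, Set.mem_singleton_iff]; tauto)
      (by
        intro j h2 h3
        rw [hs]; right
        refine ⟨hj j (by omega) (by omega), ?_⟩
        rw [Set.mem_singleton_iff, cast_inj (by omega) (by omega)]; omega)
    have hu : ups n (a + 1) (m + 1) = ((a + 1 : ℕ) : ZMod n) :: ups n (a + 1 + 1) m := by
      simp [ups, List.range'_succ]
    rw [hu]
    refine ⟨⟨h1, by rw [e1]; exact h, i1⟩, ?_⟩
    rw [run, i2, hs, show a + 1 + m = a + (m + 1) by ring]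
    ext x
    simp only [Set.mem_insert_iff, Set.mem_sdiff, Set.mem_singleton_iff]
    by_cases hx : x = ((a + 1 : ℕ) : ZMod n)
    · subst hx; tauto
    · tauto

theorem hop_down {n : ℕ} (m : ℕ) : ∀ (a : ℕ) (S : Set (ZMod n)), a + m < n →
    ((a + m : ℕ) : ZMod n) ∈ S →
    (∀ j, a ≤ j → j < a + m → (j : ZMod n) ∉ S) →
    Hop S (ups n (a + 1) m).reverse ∧
      run S (ups n (a + 1) m).reverse = insert (a : ZMod n) (S \ {((a + m : ℕ) : ZMod n)}) := by
  induction m with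
  | zero =>
    intro a S _ h _
    simp only [Nat.add_zero] at h
    simp [Hop, run, h, ups]
  | succ m ih =>
    intro a S hn h hj
    have e1 : (((a + (m + 1) : ℕ) : ZMod n)) - 1 = ((a + m : ℕ) : ZMod n) := by push_cast; ring
    have hs : step ((a + (m + 1) : ℕ) : ZMod n) S =
        insert ((a + m : ℕ) : ZMod n) (S \ {((a + (m + 1) : ℕ) : ZMod n)}) := by
      rw [step, e1]
    have h1 := hj (a + m) (by omega) (by omega)
    obtain ⟨i1, i2⟩ := ih a (step ((a + (m + 1) : ℕ) : ZMod n) S) (by omega)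
      (by rw [hs]; left; rfl)
      (by
        intro j h2 h3 h4
        rw [hs] at h4
        rcases h4 with h4 | h4
        · rw [cast_inj (by omega) (by omega)] at h4; omega
        · exact hj j h2 (by omega) h4.1)
    have hu : (ups n (a + 1) (m + 1)).reverse =
        ((a + (m + 1) : ℕ) : ZMod n) :: (ups n (a + 1) m).reverse := by
      simp [ups, List.range'_concat]; ring
    rw [hu]
    refine ⟨⟨h, by rw [e1]; exact h1, i1⟩, ?_⟩
    rw [run, i2, hs]
    ext x
    simp only [Set.mem_insert_iff, Set.mem_sdiff, Set.mem_singleton_iff]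
    by_cases hx : x = ((a + m : ℕ) : ZMod n)
    · subst hx; tauto
    · tauto

def S0 (n i : ℕ) : Set (ZMod n) := {z | i < z.val}

theorem mem_S0 {n i j : ℕ} (hj : j < n) : (j : ZMod n) ∈ S0 n i ↔ i < j := by
  simp [S0, ZMod.val_natCast_of_lt hj]

theorem set_ext_cast {n : ℕ} (hn : 3 ≤ n) {S T : Set (ZMod n)}
    (h : ∀ j : ℕ, j < n → ((j : ZMod n) ∈ S ↔ (j : ZMod n) ∈ T)) : S = T := by
  have : NeZero n := ⟨by omega⟩
  ext z
  have := h z.val (ZMod.val_lt z)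
  rwa [ZMod.natCast_zmod_val] at this

theorem zero_sub_one {n : ℕ} (hn : 3 ≤ n) : (0 : ZMod n) - 1 = ((n - 1 : ℕ) : ZMod n) := by
  rw [Nat.cast_sub (by omega)]; simp

theorem step_zero {n : ℕ} (hn : 3 ≤ n) (S : Set (ZMod n)) :
    step 0 S = insert ((n - 1 : ℕ) : ZMod n) (S \ {((0 : ℕ) : ZMod n)}) := by
  rw [step, zero_sub_one hn, Nat.cast_zero]

def WL (n i : ℕ) : List (ZMod n) := 0 :: (ups n 1 i ++ (ups n (i + 1) (n - 1 - i)).reverse)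

theorem WL_mem {n i : ℕ} (hn : 3 ≤ n) (hi : i ≤ n - 2) (z : ZMod n) : z ∈ WL n i := by
  have : NeZero n := ⟨by omega⟩
  have hz := ZMod.val_lt z
  obtain ⟨j, hj⟩ : ∃ j, j = z.val := ⟨_, rfl⟩
  have hzj : z = (j : ZMod n) := by rw [hj, ZMod.natCast_zmod_val]
  rw [← hj] at hz
  subst hzj
  clear hj
  simp only [WL, List.mem_cons, List.mem_append, List.mem_reverse, ups, List.mem_map,
    List.mem_range'_1]
  rcases Nat.eq_zero_or_pos j with h | h
  · left; simp [h]
  · by_cases h' : j ≤ i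
    · right; left; exact ⟨j, by omega, rfl⟩
    · right; right; exact ⟨j, by omega, rfl⟩

theorem W_fwd {n i : ℕ} (hn : 3 ≤ n) (hi : i ≤ n - 2) :
    Hop (S0 n i)ᶜ (WL n i) ∧ run (S0 n i)ᶜ (WL n i) = (S0 n i)ᶜ := by
  have key : ∀ j, j < n → ((j : ZMod n) ∈ step 0 (S0 n i)ᶜ ↔ j = n - 1 ∨ (j ≤ i ∧ j ≠ 0)) := by
    intro j hj
    rw [step_zero hn]
    simp only [Set.mem_insert_iff, Set.mem_sdiff, Set.mem_singleton_iff, Set.mem_compl_iff,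
      mem_S0 hj, cast_inj hj (show n - 1 < n by omega), cast_inj hj (show 0 < n by omega)]
    omega
  obtain ⟨a1, a2⟩ := hop_up (n := n) i 0 (step 0 (S0 n i)ᶜ) (by omega)
    (by rw [key 0 (by omega)]; omega) (by intro j _ _; rw [key j (by omega)]; omega)
  simp only [Nat.zero_add] at a1 a2
  have key2 : ∀ j, j < n → ((j : ZMod n) ∈ run (step 0 (S0 n i)ᶜ) (ups n 1 i) ↔
      j = n - 1 ∨ j < i) := by
    intro j hj
    rw [a2]
    simp only [Set.mem_insert_iff, Set.mem_sdiff, Set.mem_singleton_iff, key j hj,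
      cast_inj hj (show 0 < n by omega), cast_inj hj (show i < n by omega)]
    omega
  obtain ⟨b1, b2⟩ := hop_down (n := n) (n - 1 - i) i (run (step 0 (S0 n i)ᶜ) (ups n 1 i)) (by omega)
    (by rw [key2 _ (by omega)]; omega) (by intro j _ _; rw [key2 j (by omega)]; omega)
  refine ⟨⟨?_, ?_, ?_⟩, ?_⟩
  · have := @mem_S0 n i 0 (by omega)
    rw [Nat.cast_zero] at this
    simp [this]
  · rw [zero_sub_one hn, Set.mem_compl_iff, mem_S0 (by omega)]; omega
  · rw [hop_append]; exact ⟨a1, b1⟩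
  · rw [WL, run, run_append, b2]
    apply set_ext_cast hn
    intro j hj
    simp only [Set.mem_insert_iff, Set.mem_sdiff, Set.mem_singleton_iff, Set.mem_compl_iff,
      mem_S0 hj, key2 j hj,
      cast_inj hj (show i + (n - 1 - i) < n by omega), cast_inj hj (show i < n by omega)]
    omega

theorem W_bwd {n i : ℕ} (hn : 3 ≤ n) (hi : i ≤ n - 2) :
    Hop (S0 n i) (WL n i).reverse ∧ run (S0 n i) (WL n i).reverse = S0 n i := by
  have e : (WL n i).reverse = ups n (i + 1) (n - 1 - i) ++ ((ups n 1 i).reverse ++ [0]) := by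
    simp [WL]
  obtain ⟨a1, a2⟩ := hop_up (n := n) (n - 1 - i) i (S0 n i) (by omega)
    (by rw [mem_S0 (by omega)]; omega) (by intro j _ _; rw [mem_S0 (by omega)]; omega)
  have key : ∀ j, j < n → ((j : ZMod n) ∈ run (S0 n i) (ups n (i + 1) (n - 1 - i)) ↔
      i ≤ j ∧ j ≠ n - 1) := by
    intro j hj
    rw [a2]
    simp only [Set.mem_insert_iff, Set.mem_sdiff, Set.mem_singleton_iff, 
      mem_S0 hj, cast_inj hj (show i + (n - 1 - i) < n by omega), cast_inj hj (show i < n by omega)]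
    omega
  obtain ⟨b1, b2⟩ := hop_down (n := n) i 0 (run (S0 n i) (ups n (i + 1) (n - 1 - i))) (by omega)
    (by rw [key _ (by omega)]; omega) (by intro j _ _; rw [key j (by omega)]; omega)
  simp only [Nat.zero_add] at b1 b2
  have key2 : ∀ j, j < n → ((j : ZMod n) ∈ run (run (S0 n i) (ups n (i + 1) (n - 1 - i))) (ups n 1 i).reverse ↔
      j = 0 ∨ (i < j ∧ j ≠ n - 1)) := by
    intro j hj
    rw [b2]
    simp only [Set.mem_insert_iff, Set.mem_sdiff, Set.mem_singleton_iff, key j hj,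
      cast_inj hj (show 0 < n by omega), cast_inj hj (show i < n by omega)]
    omega
  rw [e, hop_append, hop_append, run_append, run_append]
  refine ⟨⟨a1, b1, ?_, ?_, trivial⟩, ?_⟩
  · have := key2 0 (by omega)
    rw [Nat.cast_zero] at this
    rw [this]; omega
  · rw [zero_sub_one hn, key2 _ (by omega)]; omega
  · rw [run, run, step_zero hn]
    apply set_ext_cast hn
    intro j hj
    simp only [Set.mem_insert_iff, Set.mem_sdiff, Set.mem_singleton_iff, 
      mem_S0 hj, key2 j hj,
      cast_inj hj (show n - 1 < n by omega), cast_inj hj (show 0 < n by omega)]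
    omega

theorem toList_W {n i : ℕ} (hn : 3 ≤ n) (hi : i ≤ n - 2) :
    FreeMonoid.toList (fx n n * qw n i) = WL n i := by
  simp only [fx, qw, asc_list, desc_list, WL, FreeMonoid.toList_mul, FreeMonoid.toList_of,
    ZMod.natCast_self, List.singleton_append]
  rw [show i + 1 - 1 = i by omega, show n - 1 + 1 - (i + 1) = n - 1 - i by omega]

theorem A_hop {n s : ℕ} (k : ℕ → ℕ) (hs : 1 ≤ s → 1 ≤ k s ∧ k s ≤ s) (m : ℕ) :
    ∀ (S : Set (ZMod n)) (K : ℕ), K < n → s + m ≤ K →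
    (∀ t, s + 1 ≤ t → t ≤ s + m → t < k t) →
    (∀ t, s + 1 ≤ t → t + 1 ≤ s + m → k t < k (t + 1)) →
    (1 ≤ m → k (s + m) ≤ K) →
    (∀ j, j < s + m → (j : ZMod n) ∉ S) → (∀ j, s + m ≤ j → j ≤ K → (j : ZMod n) ∈ S) →
    Hop S (FreeMonoid.toList ((if s = 0 then 1 else seg n (k s) s) *
        ((List.range' (s + 1) m).map fun t => seg n (k t) t).prod)).reverse := by
  induction m with
  | zero =>
    intro S K hK hsK _ _ _ h1 h2
    simp only [List.range'_zero, List.map_nil, List.prod_nil, mul_one]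
    split_ifs with h0
    · simp [Hop]
    · obtain ⟨hk1, hk2⟩ := hs (by omega)
      have e := (hop_down (n := n) (s + 1 - k s) (k s - 1) S (by omega)
        (h2 _ (by omega) (by omega)) (by intro j _ _; exact h1 j (by omega))).1
      rw [show k s - 1 + 1 = k s by omega] at e
      simpa [seg, hk2, asc_list] using e
  | succ m ih =>
    intro S K hK hsK ht htt hk h1 h2
    have hkt := ht (s + m + 1) (by omega) (by omega)
    have hkK := hk (by omega)
    rw [← add_assoc] at hkK
    obtain ⟨e1, e2⟩ := hop_up (n := n) (k (s + m + 1) - (s + m)) (s + m) S (by omega)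
      (h1 _ (by omega)) (by intro j _ _; exact h2 j (by omega) (by omega))
    have := ih (run S (ups n (s + m + 1) (k (s + m + 1) - (s + m)))) (k (s + m + 1) - 1)
      (by omega) (by omega) (fun t a b => ht t a (by omega)) (fun t a b => htt t a (by omega))
      (by
        intro hm
        have := htt (s + m) (by omega) (by omega)
        omega)
      (by
        intro j hj
        rw [e2]
        have := h1 j (by omega)
        simp only [Set.mem_insert_iff, Set.mem_sdiff, Set.mem_singleton_iff,
          cast_inj (show j < n by omega) (show s + m < n by omega), this, false_and, or_false]
        omega)
      (by
        intro j hj hj'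
        rw [e2]
        simp only [Set.mem_insert_iff, Set.mem_sdiff, Set.mem_singleton_iff,
          cast_inj (show j < n by omega) (show s + m < n by omega),
          cast_inj (show j < n by omega) (show s + m + (k (s + m + 1) - (s + m)) < n by omega)]
        refine ⟨?_, by omega⟩
        by_cases hjs : j = s + m
        · exact Or.inl hjs
        · exact Or.inr (h2 j (by omega) (by omega)))
    rw [List.range'_concat, List.map_append, List.prod_append, ← mul_assoc,
      FreeMonoid.toList_mul, List.reverse_append, hop_append]
    have e3 : (FreeMonoid.toList (List.map (fun t => seg n (k t) t) [s + 1 + 1 * m]).prod).reverse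
        = ups n (s + m + 1) (k (s + m + 1) - (s + m)) := by
      rw [show s + 1 + 1 * m = s + m + 1 by ring]
      simp only [List.map_cons, List.map_nil, List.prod_singleton]
      rw [seg, if_neg (by omega), desc_list, List.reverse_reverse,
        show k (s + m + 1) + 1 - (s + m + 1) = k (s + m + 1) - (s + m) by omega]
    rw [e3]
    exact ⟨e1, this⟩

theorem B_hop {n : ℕ} (hn : 3 ≤ n) (I J : ℕ → ℕ) (r : ℕ) :
    ∀ (c : ℕ) (S : Set (ZMod n)) (bI bJ : ℕ), bI < bJ → bJ ≤ n - 1 →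
    (∀ t, c ≤ t → t < c + r → 1 ≤ I t) →
    (∀ t, c ≤ t → t + 1 < c + r → I (t + 1) < I t) →
    (1 ≤ r → I c ≤ bI) → bJ < J c →
    (∀ t, c ≤ t → t < c + r → J t < J (t + 1)) →
    (∀ t, c ≤ t → t ≤ c + r → J t ≤ n) →
    (∀ j, j ≤ bI → (j : ZMod n) ∈ S) → (∀ j, bJ ≤ j → j < n → (j : ZMod n) ∉ S) →
    Hop S (FreeMonoid.toList (((List.range' c r).map fun t =>
          fx n n * asc n 1 (I t) * desc n (n - 1) (J t)).prod *
        (fx n n * desc n (n - 1) (J (c + r))))) := by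
  induction r with
  | zero =>
    intro c S bI bJ hIJ hbJ _ _ _ hJc _ hJn h1 h2
    have hJ := hJn c (by omega) (by omega)
    simp only [List.range'_zero, List.map_nil, List.prod_nil, one_mul, fx, desc_list,
      FreeMonoid.toList_mul, FreeMonoid.toList_of, ZMod.natCast_self,
      List.singleton_append, Nat.add_zero]
    refine ⟨by simpa using h1 0 (by omega), by rw [zero_sub_one hn]; exact h2 _ (by omega) (by omega), ?_⟩
    have := (hop_down (n := n) (n - J c) (J c - 1) (step 0 S) (by omega)
      (by rw [step_zero hn]; left; congr 1; omega)
      (by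
        intro j _ _
        have := h2 j (by omega) (by omega)
        rw [step_zero hn]
        simp only [Set.mem_insert_iff, Set.mem_sdiff, Set.mem_singleton_iff,
          cast_inj (show j < n by omega) (show n - 1 < n by omega), this, false_and, or_false]
        omega)).1
    rw [show J c - 1 + 1 = J c by omega] at this
    rw [show n - 1 + 1 - J c = n - J c by omega]
    exact this
  | succ r ih =>
    intro c S bI bJ hIJ hbJ hI1 hI2 hIc hJc hJ2 hJn h1 h2
    have hI := hI1 c (by omega) (by omega)
    have hIb := hIc (by omega)
    have hJJ := hJ2 c (by omega) (by omega)
    have hJ1 := hJn (c + 1) (by omega) (by omega)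
    have key : ∀ j, j < n → ((j : ZMod n) ∈ step 0 S ↔ j = n - 1 ∨ ((j : ZMod n) ∈ S ∧ j ≠ 0)) := by
      intro j hj
      rw [step_zero hn]
      simp only [Set.mem_insert_iff, Set.mem_sdiff, Set.mem_singleton_iff, 
        cast_inj hj (show n - 1 < n by omega), cast_inj hj (show 0 < n by omega)]
    obtain ⟨a1, a2⟩ := hop_up (n := n) (I c) 0 (step 0 S) (by omega)
      (by rw [key 0 (by omega)]; omega)
      (by intro j _ _; rw [key j (by omega)]; exact Or.inr ⟨h1 j (by omega), by omega⟩)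
    simp only [Nat.zero_add] at a1 a2
    have key2 : ∀ j, j < n → ((j : ZMod n) ∈ run (step 0 S) (ups n 1 (I c)) ↔
        (j = 0 ∨ j = n - 1 ∨ (j : ZMod n) ∈ S) ∧ j ≠ I c) := by
      intro j hj
      rw [a2]
      simp only [Set.mem_insert_iff, Set.mem_sdiff, Set.mem_singleton_iff, key j hj,
        cast_inj hj (show 0 < n by omega), cast_inj hj (show I c < n by omega)]
      tauto
    obtain ⟨b1, b2⟩ := hop_down (n := n) (n - J c) (J c - 1) (run (step 0 S) (ups n 1 (I c)))
      (by omega)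
      (by rw [key2 _ (by omega)]; omega)
      (by
        intro j _ _
        have := h2 j (by omega) (by omega)
        rw [key2 j (by omega)]
        simp only [this, false_and, or_false]
        omega)
    rw [show J c - 1 + 1 = J c by omega] at b1 b2
    have key3 : ∀ j, j < n → ((j : ZMod n) ∈ run (run (step 0 S) (ups n 1 (I c)))
        (ups n (J c) (n - J c)).reverse ↔
        j = J c - 1 ∨ ((j = 0 ∨ j = n - 1 ∨ (j : ZMod n) ∈ S) ∧ j ≠ I c) ∧ j ≠ n - 1) := by
      intro j hj
      rw [b2, show J c - 1 + (n - J c) = n - 1 by omega]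
      simp only [Set.mem_insert_iff, Set.mem_sdiff, Set.mem_singleton_iff, key2 j hj,
        cast_inj hj (show n - 1 < n by omega), cast_inj hj (show J c - 1 < n by omega)]
    have := ih (c + 1) (run (run (step 0 S) (ups n 1 (I c))) (ups n (J c) (n - J c)).reverse)
      (I c - 1) (J c) (by omega) (by omega)
      (fun t a b => hI1 t (by omega) (by omega)) (fun t a b => hI2 t (by omega) (by omega))
      (by
        intro hr
        have := hI2 c (by omega) (by omega)
        omega)
      hJJ (fun t a b => hJ2 t (by omega) (by omega)) (fun t a b => hJn t (by omega) (by omega))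
      (by
        intro j hj
        rw [key3 j (by omega)]
        exact Or.inr ⟨⟨Or.inr (Or.inr (h1 j (by omega))), by omega⟩, by omega⟩)
      (by
        intro j hj hj'
        have := h2 j (by omega) (by omega)
        rw [key3 j (by omega)]
        simp only [this, false_and, or_false]
        omega)
    rw [List.range'_succ, List.map_cons, List.prod_cons, mul_assoc, FreeMonoid.toList_mul,
      show c + (r + 1) = c + 1 + r by ring]
    have e3 : FreeMonoid.toList (fx n n * asc n 1 (I c) * desc n (n - 1) (J c)) =
        0 :: (ups n 1 (I c) ++ (ups n (J c) (n - J c)).reverse) := by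
      simp only [fx, asc_list, desc_list, FreeMonoid.toList_mul, FreeMonoid.toList_of,
        ZMod.natCast_self, List.singleton_append, List.cons_append]
      rw [show I c + 1 - 1 = I c by omega, show n - 1 + 1 - J c = n - J c by omega]
      rfl
    rw [e3, hop_append]
    refine ⟨⟨by simpa using h1 0 (by omega), by rw [zero_sub_one hn]; exact h2 _ (by omega) (by omega), ?_⟩, ?_⟩
    · rw [hop_append]; exact ⟨a1, b1⟩
    · rw [run, run_append]; exact this

theorem pr_list (n : ℕ) (w : FreeMonoid (ZMod n)) :
    pr n w = ((FreeMonoid.toList w).map fun a => pr n (FreeMonoid.of a)).prod := by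
  induction w using FreeMonoid.recOn with
  | one => simp
  | of_mul x xs h => simp [h]

theorem pr_rel {n : ℕ} {w v : FreeMonoid (ZMod n)} (h : cnRel n w v) : pr n w = pr n v :=
  (Con.eq _).2 (ConGen.Rel.of _ _ h)

theorem pr_comm (n : ℕ) (a b : ZMod n) (h1 : b ≠ a + 1) (h2 : a ≠ b + 1) :
    pr n (FreeMonoid.of a) * pr n (FreeMonoid.of b) =
      pr n (FreeMonoid.of b) * pr n (FreeMonoid.of a) := by
  rw [← map_mul, ← map_mul]
  exact pr_rel (Or.inr (Or.inl ⟨a, b, h1, h2, rfl, rfl⟩))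

theorem A_complete {n i : ℕ} (hn : 3 ≤ n) (hi : i ≤ n - 2) (a : FreeMonoid (ZMod n))
    (ha : InA n i a) : ∃ (u : Cn n) (N : ℕ), u * pr n a = pr n (fx n n * qw n i) ^ N := by
  obtain ⟨s, k, hs, hks, h1, h2, p, hp⟩ := ha
  obtain ⟨e1, e2⟩ := W_bwd hn hi
  have hh := A_hop (n := n) (s := s) k hks (i + 1 - s) (S0 n i) (n - 1) (by omega) (by omega)
    (fun t a b => (h1 t a (by omega)).1) (fun t a b => h2 t a (by omega))
    (fun hm => (h1 _ (by omega) (by omega)).2)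
    (fun j hj => by rw [mem_S0 (by omega)]; omega)
    (fun j hj hj' => by rw [mem_S0 (by omega)]; omega)
  rw [← hp] at hh
  obtain ⟨m, N, h⟩ := hop_complete (M := (Cn n)ᵐᵒᵖ)
    (fun a => MulOpposite.op (pr n (FreeMonoid.of a)))
    (fun a b h1 h2 => by rw [← MulOpposite.op_mul, ← MulOpposite.op_mul, pr_comm n a b h1 h2])
    (S0 n i) _ _ e1 e2 (fun z => List.mem_reverse.2 (WL_mem hn hi z)) hh
  have conv : ∀ l : List (ZMod n),
      (l.reverse.map fun a => MulOpposite.op (pr n (FreeMonoid.of a))).prod =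
      MulOpposite.op ((l.map fun a => pr n (FreeMonoid.of a)).prod) := by
    intro l
    induction l with
    | nil => simp
    | cons x l ih => rw [List.reverse_cons, List.map_append, List.prod_append, ih]; simp
  rw [conv, conv, ← toList_W hn hi, ← pr_list, ← pr_list] at h
  refine ⟨m.unop * pr n p, N, ?_⟩
  have h' := congrArg MulOpposite.unop h
  simp only [MulOpposite.unop_mul, MulOpposite.unop_op, MulOpposite.unop_pow] at h'
  rw [mul_assoc, ← map_mul, h']

theorem B_complete {n i : ℕ} (hn : 3 ≤ n) (hi : i ≤ n - 2) (b : FreeMonoid (ZMod n))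
    (hb : InB n i b) : ∃ (v : Cn n) (N : ℕ), pr n b * v = pr n (fx n n * qw n i) ^ N := by
  obtain ⟨r, I, J, hI, hI2, hJ1, hJ2, hJn, p, hp⟩ := hb
  obtain ⟨e1, e2⟩ := W_fwd hn hi
  have hJn' : ∀ d t, 1 ≤ t → t + d = r + 1 → J t ≤ n := by
    intro d
    induction d with
    | zero => intro t _ h; rw [show t = r + 1 by omega]; exact hJn
    | succ d ih =>
      intro t h h'
      have := ih (t + 1) (by omega) (by omega)
      have := hJ2 t h (by omega)
      omega
  have hh := B_hop (n := n) hn I J r 1 (S0 n i)ᶜ i (i + 1) (by omega) (by omega)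
    (fun t a b => (hI t a (by omega)).1) (fun t a b => hI2 t a (by omega))
    (fun hm => by have := (hI 1 (by omega) (by omega)).2; omega)
    hJ1 (fun t a b => hJ2 t a (by omega))
    (fun t a b => hJn' (r + 1 - t) t a (by omega))
    (fun j hj => by rw [Set.mem_compl_iff, mem_S0 (by omega)]; omega)
    (fun j hj hj' => by rw [Set.mem_compl_iff, mem_S0 (by omega)]; omega)
  rw [show 1 + r = r + 1 by ring, ← hp] at hh
  obtain ⟨m, N, h⟩ := hop_complete (M := Cn n) (fun a => pr n (FreeMonoid.of a))
    (pr_comm n) (S0 n i)ᶜ _ _ e1 e2 (WL_mem hn hi) hh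
  rw [← toList_W hn hi, ← pr_list, ← pr_list] at h
  exact ⟨pr n p * m, N, by rw [← mul_assoc, ← map_mul, h]⟩

def hx (n : ℕ) (a : ZMod n) : Function.End (ZMod n) := fun z => if z = a then a - 1 else z

def hF (n : ℕ) : FreeMonoid (ZMod n) →* Function.End (ZMod n) := FreeMonoid.lift (hx n)

theorem two_ne {n : ℕ} (hn : 3 ≤ n) : (1 : ZMod n) ≠ 0 ∧ (2 : ZMod n) ≠ 0 := by
  have h1 := @cast_inj n 1 0 (by omega) (by omega)
  have h2 := @cast_inj n 2 0 (by omega) (by omega)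
  simp at h1 h2
  exact ⟨h1, by simpa using h2⟩

theorem hF_rel {n : ℕ} (hn : 3 ≤ n) (w v : FreeMonoid (ZMod n)) (h : cnRel n w v) :
    hF n w = hF n v := by
  obtain ⟨one_ne, two_ne⟩ := two_ne hn
  have hm : ∀ (f g : Function.End (ZMod n)) z, (f * g) z = f (g z) := fun _ _ _ => rfl
  have s1 : ∀ a : ZMod n, a - 1 ≠ a := fun a h => one_ne (by linear_combination -h)
  have s2 : ∀ a : ZMod n, a - 1 ≠ a + 1 := fun a h => two_ne (by linear_combination -h)
  have s3 : ∀ a : ZMod n, a ≠ a + 1 := fun a h => one_ne (by linear_combination -h)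
  rcases h with ⟨a, rfl, rfl⟩ | ⟨a, b, h1, h2, rfl, rfl⟩ | ⟨a, rfl | rfl, rfl⟩
  all_goals
    funext z
    simp only [map_mul, hF, FreeMonoid.lift_eval_of, hm, hx]
  · by_cases h : z = a <;> simp [h, s1]
  · have q1 : a - 1 ≠ b := fun h => h2 (by rw [← h]; ring)
    have q2 : b - 1 ≠ a := fun h => h1 (by rw [← h]; ring)
    by_cases h : z = a
    · by_cases h' : z = b
      · rw [← h, ← h']
      · subst h; simp [h', q1]
    · by_cases h' : z = b
      · subst h'; simp [h, q2]
      · simp [h, h']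
  · by_cases h : z = a
    · subst h; simp [s1, s2, s3]
    · by_cases h' : z = a + 1
      · simp [h', one_ne, s1]
      · simp [h, h']
  · by_cases h : z = a
    · subst h; simp [s1, s2, s3]
    · by_cases h' : z = a + 1
      · simp [h, h', s1, s2, s3]
      · simp [h, h']

theorem hF_con {n : ℕ} (hn : 3 ≤ n) : conGen (cnRel n) ≤ Con.ker (hF n) :=
  Con.conGen_le.2 fun w v h => hF_rel hn w v h

def hC {n : ℕ} (hn : 3 ≤ n) : Cn n →* Function.End (ZMod n) :=
  Con.lift (conGen (cnRel n)) (hF n) (hF_con hn)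

theorem hC_pr {n : ℕ} (hn : 3 ≤ n) (w : FreeMonoid (ZMod n)) : hC hn (pr n w) = hF n w := rfl

def img {n : ℕ} (f : Function.End (ZMod n)) (S : Set (ZMod n)) : Set (ZMod n) :=
  Set.image (fun z => f z) S

theorem img_one {n : ℕ} (S : Set (ZMod n)) : img 1 S = S := Set.image_id S

theorem img_mul {n : ℕ} (f g : Function.End (ZMod n)) (S : Set (ZMod n)) :
    img (f * g) S = img f (img g S) := Set.image_comp (fun z => f z) (fun z => g z) S

theorem img_hx {n : ℕ} (a : ZMod n) (S : Set (ZMod n)) (h1 : a ∈ S) : img (hx n a) S = step a S := by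
  ext z
  constructor
  · rintro ⟨y, hy, rfl⟩
    by_cases hya : y = a
    · left; exact if_pos hya
    · right
      have : hx n a y = y := if_neg hya
      change hx n a y ∈ _
      rw [this]; exact ⟨hy, hya⟩
  · rintro (rfl | ⟨hz, hz'⟩)
    · exact ⟨a, h1, if_pos rfl⟩
    · exact ⟨z, hz, if_neg hz'⟩

theorem hop_image {n : ℕ} (l : List (ZMod n)) : ∀ S : Set (ZMod n), Hop S l →
    img (hF n (FreeMonoid.ofList l.reverse)) S = run S l := by
  induction l with
  | nil =>
    intro S _
    rw [List.reverse_nil, FreeMonoid.ofList_nil, map_one, img_one, run]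
  | cons a l ih =>
    intro S h
    obtain ⟨h1, h2, h3⟩ := h
    have : hF n (FreeMonoid.ofList [a]) = hx n a := by
      rw [FreeMonoid.ofList_singleton]; simp [hF]
    rw [run, ← ih _ h3, List.reverse_cons, FreeMonoid.ofList_append, map_mul, img_mul, this,
      img_hx a S h1]

theorem hF_avoid {n : ℕ} (hn : 3 ≤ n) (m : ℕ) : ∀ (a j : ℕ), a ≤ j → j < a + m → a + m ≤ n - 1 →
    ∀ z, hF n (FreeMonoid.ofList (ups n a m)) z ≠ (j : ZMod n) := by
  obtain ⟨one_ne, two_ne⟩ := two_ne hn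
  induction m with
  | zero => intros; omega
  | succ m ih =>
    intro a j h1 h2 h3 z
    have e : hF n (FreeMonoid.ofList (ups n a (m + 1))) z =
        hx n a (hF n (FreeMonoid.ofList (ups n (a + 1) m)) z) := by
      simp only [ups, List.range'_succ, List.map_cons, FreeMonoid.ofList_cons, map_mul]
      rfl
    rw [e, hx]
    split_ifs with h
    · intro h'
      rcases Nat.eq_zero_or_pos a with h0 | h0
      · subst h0
        rw [Nat.cast_zero, zero_sub_one hn, cast_inj (by omega) (by omega)] at h'
        omega
      · obtain ⟨a, rfl⟩ : ∃ a', a = a' + 1 := ⟨a - 1, by omega⟩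
        rw [Nat.cast_succ, add_sub_cancel_right, cast_inj (by omega) (by omega)] at h'
        omega
    · rcases Nat.eq_or_lt_of_le h1 with rfl | h4
      · exact h
      · exact ih (a + 1) j (by omega) (by omega) (by omega) z

theorem hF_range {n i : ℕ} (hn : 3 ≤ n) (hi : i ≤ n - 2) :
    Set.range (hF n (fx n n * qw n i)) ⊆ S0 n i := by
  have : NeZero n := ⟨by omega⟩
  rintro _ ⟨z, rfl⟩
  by_contra hc
  simp only [S0, Set.mem_ofPred_eq, not_lt] at hc
  have e : fx n n * qw n i = FreeMonoid.ofList (ups n 0 (i + 1)) * desc n (n - 1) (i + 1) := by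
    rw [qw, ← mul_assoc]
    congr 1
    apply FreeMonoid.toList.injective
    simp [fx, asc_list, ups, List.range'_succ]
  have := hF_avoid hn (i + 1) 0 _ (Nat.zero_le _)
    (show (hF n (fx n n * qw n i) z).val < 0 + (i + 1) by omega) (by omega)
    (hF n (desc n (n - 1) (i + 1)) z)
  apply this
  rw [ZMod.natCast_zmod_val, e, map_mul]
  rfl

/-- Proposition 3.14 (stw2): `M̃_i ⊆ I_{i-1} \ I_i`. -/
theorem stmt10 (n i : ℕ) (hn : 3 ≤ n) (hi : i ≤ n - 2)
    (a b : FreeMonoid (ZMod n)) (k : ℕ) (ha : InA n i a) (hb : InB n i b)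
    (hk : 1 ≤ k) :
    (pr n a * (pr n (fx n n * qw n i)) ^ k * pr n b ∈
      if i = 0 then Im1 n else Iset n (i - 1)) ∧
    pr n a * (pr n (fx n n * qw n i)) ^ k * pr n b ∉ Iset n i := by
  have : NeZero n := ⟨by omega⟩
  obtain ⟨k, rfl⟩ : ∃ k', k = k' + 1 := ⟨k - 1, by omega⟩
  constructor
  · split_ifs with h0
    · subst h0
      right
      exact ⟨pr n a, pr n (fx n n * qw n 0) ^ k * pr n b, by rw [pow_succ']; simp only [mul_assoc]⟩
    · rintro ⟨u, v, k', hk', h⟩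
      replace h := congrArg (hC hn) h
      obtain ⟨e1, e2⟩ := W_bwd (i := i - 1) hn (by omega)
      have hT : img (hF n (fx n n * qw n (i - 1))) (S0 n (i - 1)) = S0 n (i - 1) := by
        have := hop_image _ _ e1
        rwa [e2, List.reverse_reverse, ← toList_W hn (by omega), FreeMonoid.ofList_toList] at this
      have hTk : img ((hF n (fx n n * qw n (i - 1))) ^ k') (S0 n (i - 1)) = S0 n (i - 1) := by
        clear h hk'
        induction k' with
        | zero => rw [pow_zero, img_one]
        | succ q ih =>
          rw [pow_succ, img_mul, hT, ih]
      rw [map_pow, hC_pr] at h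
      rw [← h] at hTk
      have hfac : hC hn (u * (pr n a * pr n (fx n n * qw n i) ^ (k + 1) * pr n b) * v) =
          hC hn (u * pr n a) * hF n (fx n n * qw n i) *
            hC hn (pr n (fx n n * qw n i) ^ k * pr n b * v) := by
        rw [← hC_pr hn, ← map_mul, ← map_mul, pow_succ']
        simp only [mul_assoc]
      rw [hfac] at hTk
      have hsub : S0 n (i - 1) ⊆ img (hC hn (u * pr n a)) (S0 n i) := by
        rw [← hTk]
        rintro _ ⟨z, _, rfl⟩
        exact ⟨_, hF_range hn hi ⟨_, rfl⟩, rfl⟩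
      have c1 : (S0 n (i - 1)).ncard ≤ (S0 n i).ncard :=
        (Set.ncard_le_ncard hsub (Set.toFinite _)).trans (Set.ncard_image_le (Set.toFinite _))
      have c2 : (S0 n i).ncard < (S0 n (i - 1)).ncard := by
        apply Set.ncard_lt_ncard _ (Set.toFinite _)
        rw [Set.ssubset_iff_of_subset]
        · exact ⟨(i : ZMod n), (mem_S0 (by omega)).2 (by omega), by
            rw [mem_S0 (by omega)]; omega⟩
        · intro z hz
          simp only [S0, Set.mem_ofPred_eq] at *
          omega
      omega
  · intro h
    apply h
    obtain ⟨u, N, hu⟩ := A_complete hn hi a ha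
    obtain ⟨v, N', hv⟩ := B_complete hn hi b hb
    refine ⟨u, v, N + (k + 1) + N', by omega, ?_⟩
    calc _ = (u * pr n a) * pr n (fx n n * qw n i) ^ (k + 1) * (pr n b * v) := by
          simp only [mul_assoc]
      _ = _ := by rw [hu, hv, ← pow_add, ← pow_add]

end HK
end

section
/- Let n ≥ 4. There is an injective monoid homomorphism φ̄ : C_{n−1} → C_n determined on the generators y_1,…,y_{n−1} of C_{n−1} by φ̄(y_i) = x_{i+1} for 1 ≤ i ≤ n−2 and φ̄(y_{n−1}) = x_n x_1. Its image is the submonoid of C_n generated by x_2,…,x_{n−1} and x_n x_1; in particular C_{n−1} is isomorphic to the submonoid of C_n generated by x_2,…,x_{n−1}, x_n x_1. -/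
namespace HK

def act (m : ℕ) (i : ZMod m) (z : ℤ) : ℤ := if (z : ZMod m) = i + 1 then z - 1 else z

def gg (m : ℕ) (i : ZMod m) : Cn m := pr m (FreeMonoid.of i)

lemma pr_eq {m : ℕ} {u v : FreeMonoid (ZMod m)} (h : cnRel m u v) : pr m u = pr m v :=
  (Con.eq _).2 (ConGen.Rel.of _ _ h)

lemma gg_sq {m : ℕ} (i : ZMod m) : gg m i * gg m i = gg m i := by
  simp only [gg, ← map_mul]
  exact pr_eq (Or.inl ⟨i, rfl, rfl⟩)

lemma gg_comm {m : ℕ} (i j : ZMod m) (h1 : j ≠ i + 1) (h2 : i ≠ j + 1) :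
    gg m i * gg m j = gg m j * gg m i := by
  simp only [gg, ← map_mul]
  exact pr_eq (Or.inr (Or.inl ⟨i, j, h1, h2, rfl, rfl⟩))

lemma gg_aba {m : ℕ} (i j : ZMod m) (h : j = i + 1) :
    gg m i * gg m j * gg m i = gg m i * gg m j := by
  subst h
  simp only [gg, ← map_mul]
  exact pr_eq (Or.inr (Or.inr ⟨i, Or.inl rfl, rfl⟩))

lemma gg_bab {m : ℕ} (i j : ZMod m) (h : j = i + 1) :
    gg m j * gg m i * gg m j = gg m i * gg m j := by
  subst h
  simp only [gg, ← map_mul]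
  exact pr_eq (Or.inr (Or.inr ⟨i, Or.inr rfl, rfl⟩))

lemma one_ne {m : ℕ} (hm : 3 ≤ m) : (1 : ZMod m) ≠ 0 := by
  intro h
  have : ((1 : ℕ) : ZMod m) = 0 := by exact_mod_cast h
  rw [ZMod.natCast_eq_zero_iff] at this
  have := Nat.le_of_dvd (by norm_num) this
  omega

lemma two_ne_s14 {m : ℕ} (hm : 3 ≤ m) : (2 : ZMod m) ≠ 0 := by
  intro h
  have : ((2 : ℕ) : ZMod m) = 0 := by exact_mod_cast h
  rw [ZMod.natCast_eq_zero_iff] at this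
  have := Nat.le_of_dvd (by norm_num) this
  omega

lemma act_rel {m : ℕ} (hm : 3 ≤ m) (u v : FreeMonoid (ZMod m)) (h : cnRel m u v) :
    FreeMonoid.lift (M := Function.End ℤ) (act m) u = FreeMonoid.lift (M := Function.End ℤ) (act m) v := by
  have h1 := one_ne hm
  have h2 := two_ne_s14 hm
  have pos : ∀ (i : ZMod m) (z : ℤ), (z : ZMod m) = i + 1 → act m i z = z - 1 :=
    fun i z h => if_pos h
  have neg : ∀ (i : ZMod m) (z : ℤ), (z : ZMod m) ≠ i + 1 → act m i z = z :=
    fun i z h => if_neg h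
  have k1 : ∀ x : ZMod m, x ≠ x + 1 := fun x h => h1 (by linear_combination -h)
  have k2 : ∀ x : ZMod m, x ≠ x + 1 + 1 := fun x h => h2 (by linear_combination -h)
  have c1 : ∀ (z : ℤ) (x : ZMod m), (z : ZMod m) = x + 1 → ((z - 1 : ℤ) : ZMod m) = x := by
    intro z x h; push_cast; rw [h]; ring
  rcases h with ⟨a, rfl, rfl⟩ | ⟨a, b, hab, hba, rfl, rfl⟩ | ⟨a, rfl | rfl, rfl⟩
  · funext z
    change act m a (act m a z) = act m a z
    by_cases h : (z : ZMod m) = a + 1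
    · rw [pos a z h, neg a _ (by rw [c1 z a h]; exact k1 a)]
    · rw [neg a z h, neg a z h]
  · funext z
    change act m a (act m b z) = act m b (act m a z)
    by_cases h : (z : ZMod m) = a + 1
    · by_cases h' : (z : ZMod m) = b + 1
      · have : a = b := by linear_combination h' - h
        rw [this]
      · rw [neg b z h', pos a z h, neg b _ (by rw [c1 z a h]; exact hba)]
    · by_cases h' : (z : ZMod m) = b + 1
      · rw [neg a z h, pos b z h', neg a _ (by rw [c1 z b h']; exact hab)]
      · rw [neg a z h, neg b z h', neg a z h]
  · funext z
    change act m a (act m (a + 1) (act m a z)) = act m a (act m (a + 1) z)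
    by_cases h : (z : ZMod m) = a + 1
    · rw [pos a z h, neg (a + 1) z (by rw [h]; exact k1 _), pos a z h,
        neg (a + 1) _ (by rw [c1 z a h]; exact k2 a), neg a _ (by rw [c1 z a h]; exact k1 a)]
    · rw [neg a z h]
  · funext z
    change act m (a + 1) (act m a (act m (a + 1) z)) = act m a (act m (a + 1) z)
    by_cases h : (z : ZMod m) = a + 1 + 1
    · rw [pos _ z h, pos a (z - 1) (c1 z _ h), neg (a + 1)]
      rw [c1 _ _ (c1 z _ h)]
      exact k2 a
    · rw [neg _ z h]
      by_cases h' : (z : ZMod m) = a + 1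
      · rw [pos a z h', neg]
        rw [c1 z a h']
        exact k2 a
      · rw [neg a z h', neg _ z h]

def RR (m : ℕ) (hm : 3 ≤ m) : Cn m →* Function.End ℤ :=
  Con.lift _ (FreeMonoid.lift (M := Function.End ℤ) (act m))
    (Con.conGen_le.2 fun u v h => act_rel hm u v h)

lemma RR_gg {m : ℕ} (hm : 3 ≤ m) (i : ZMod m) : RR m hm (gg m i) = act m i := by
  rfl

lemma RR_mul {m : ℕ} (hm : 3 ≤ m) (c d : Cn m) (z : ℤ) :
    RR m hm (c * d) z = RR m hm c (RR m hm d z) := by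
  rw [map_mul]; rfl

lemma RR_gmul {m : ℕ} (hm : 3 ≤ m) (i : ZMod m) (d : Cn m) (z : ℤ) :
    RR m hm (gg m i * d) z = act m i (RR m hm d z) := by
  rw [RR_mul, RR_gg]

lemma RR_mulg {m : ℕ} (hm : 3 ≤ m) (i : ZMod m) (d : Cn m) (z : ℤ) :
    RR m hm (d * gg m i) z = RR m hm d (act m i z) := by
  rw [RR_mul, RR_gg]

lemma RR_one {m : ℕ} (hm : 3 ≤ m) (z : ℤ) : RR m hm 1 z = z := by
  rw [map_one]; rfl

def PP (m : ℕ) (w : List (ZMod m)) : Cn m := (w.map (gg m)).prod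

lemma PP_cons {m : ℕ} (i : ZMod m) (w : List (ZMod m)) : PP m (i :: w) = gg m i * PP m w := by
  simp [PP]

lemma PP_pr {m : ℕ} (u : FreeMonoid (ZMod m)) : pr m u = PP m (FreeMonoid.toList u) := by
  induction u using FreeMonoid.inductionOn' with
  | one => simp [PP]
  | of_mul i u ih => rw [map_mul, ih]; simp [PP, gg]

lemma exists_PP {m : ℕ} (c : Cn m) : ∃ w, c = PP m w := by
  obtain ⟨u, rfl⟩ := Con.mk'_surjective c
  exact ⟨_, PP_pr u⟩

lemma Cn_ind {m : ℕ} {p : Cn m → Prop} (h1 : p 1) (hg : ∀ i c, p c → p (gg m i * c)) (c : Cn m) :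
    p c := by
  obtain ⟨w, rfl⟩ := exists_PP c
  induction w with
  | nil => simpa [PP] using h1
  | cons i w ih => rw [PP_cons]; exact hg _ _ ih

lemma Cn_ind' {m : ℕ} {p : Cn m → Prop} (h1 : p 1) (hg : ∀ i c, p c → p (c * gg m i)) (c : Cn m) :
    p c := by
  obtain ⟨w, rfl⟩ := exists_PP c
  induction w using List.reverseRecOn with
  | nil => simpa [PP] using h1
  | append_singleton w i ih =>
    have : PP m (w ++ [i]) = PP m w * gg m i := by simp [PP]
    rw [this]; exact hg _ _ ih

lemma act_le {m : ℕ} (i : ZMod m) (z : ℤ) : act m i z ≤ z := by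
  unfold act; split_ifs <;> omega

lemma act_mono {m : ℕ} (i : ZMod m) : Monotone (act m i) := by
  intro a b h
  rcases h.lt_or_eq with h | rfl
  · unfold act; split_ifs <;> omega
  · exact le_rfl

lemma act_per {m : ℕ} (i : ZMod m) (z k : ℤ) : act m i (z + m * k) = act m i z + m * k := by
  unfold act
  push_cast
  simp only [CharP.cast_eq_zero, zero_mul, add_zero]
  split_ifs <;> ring

lemma RR_le {m : ℕ} (hm : 3 ≤ m) (c : Cn m) : ∀ z, RR m hm c z ≤ z := by
  induction c using Cn_ind with
  | h1 => intro z; rw [RR_one]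
  | hg i c ih => intro z; rw [RR_gmul]; exact (act_le _ _).trans (ih z)

lemma RR_mono {m : ℕ} (hm : 3 ≤ m) (c : Cn m) : Monotone (RR m hm c) := by
  induction c using Cn_ind with
  | h1 => intro a b h; simpa only [RR_one] using h
  | hg i c ih => intro a b h; simp only [RR_gmul]; exact act_mono _ (ih h)

lemma RR_per {m : ℕ} (hm : 3 ≤ m) (c : Cn m) :
    ∀ z k : ℤ, RR m hm c (z + m * k) = RR m hm c z + m * k := by
  induction c using Cn_ind with
  | h1 => intro a b; simp only [RR_one]
  | hg i c ih => intro a b; simp only [RR_gmul, ih, act_per]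

/-- left absorption -/
lemma claim1 {m : ℕ} (hm : 3 ≤ m) (c : Cn m) :
    ∀ i, (∀ z, ((RR m hm c z : ℤ) : ZMod m) ≠ i + 1) → gg m i * c = c := by
  have h1 := one_ne hm
  have h2 := two_ne_s14 hm
  induction c using Cn_ind with
  | h1 =>
    intro i h
    obtain ⟨z, hz⟩ := ZMod.intCast_surjective (i + 1)
    exact absurd hz (by simpa only [RR_one] using h z)
  | hg j c ih =>
    intro i h
    simp only [RR_gmul] at h
    by_cases hji : j = i
    · subst hji; rw [← mul_assoc, gg_sq]
    by_cases hj1 : j = i + 1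
    · subst hj1
      have e1 : gg m (i + 1) * c = c := by
        apply ih
        intro z hz
        apply h z
        rw [act, if_pos hz]; push_cast; rw [hz]; ring
      rw [e1]
      apply ih
      intro z hz
      apply h z
      rw [act, if_neg (by rw [hz]; intro h; exact h1 (by linear_combination -h)), hz]
    have e : gg m i * c = c := by
      apply ih
      intro z hz
      apply h z
      rw [act, if_neg (by rw [hz]; grind), hz]
    by_cases hj2 : i = j + 1
    · calc gg m i * (gg m j * c) = gg m i * gg m j * gg m i * c := by
            rw [mul_assoc _ _ c, e, mul_assoc]
        _ = gg m j * c := by rw [gg_bab j i hj2, mul_assoc, e]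
    · rw [← mul_assoc, gg_comm i j hj1 hj2, mul_assoc, e]

/-- right absorption -/
lemma claim2 {m : ℕ} (hm : 3 ≤ m) (c : Cn m) :
    ∀ x : ℤ, RR m hm c x = RR m hm c (x + 1) → c * gg m (x : ZMod m) = c := by
  have h1 := one_ne hm
  have h2 := two_ne_s14 hm
  induction c using Cn_ind' with
  | h1 =>
    intro x h
    simp only [RR_one] at h
    omega
  | hg j c ih =>
    intro x h
    simp only [RR_mulg] at h
    by_cases hji : j = x
    · subst hji; rw [mul_assoc, gg_sq]
    have hx1 : act m j (x + 1) = x + 1 := by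
      rw [act, if_neg]; push_cast; grind
    rw [hx1] at h
    by_cases hj1 : (x : ZMod m) = j + 1
    · rw [act, if_pos hj1] at h
      have a1 := RR_mono hm c (show x - 1 ≤ x by omega)
      have a2 := RR_mono hm c (show x ≤ x + 1 by omega)
      have e1 := ih (x - 1) (by rw [show x - 1 + 1 = x by ring]; omega)
      have e2 := ih x (by omega)
      have : ((x - 1 : ℤ) : ZMod m) = j := by push_cast; rw [hj1]; ring
      rw [this] at e1
      rw [e1, e2]
    · rw [act, if_neg hj1] at h
      have e := ih x h
      by_cases hj2 : j = x + 1
      · calc c * gg m j * gg m x = c * gg m x * gg m j * gg m x := by rw [e]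
          _ = c * (gg m x * gg m j * gg m x) := by simp only [mul_assoc]
          _ = c * gg m j := by rw [gg_aba _ _ hj2, ← mul_assoc, e]
      · rw [mul_assoc, gg_comm j x hj1 hj2, ← mul_assoc, e]

lemma RR_no {m : ℕ} (hm : 3 ≤ m) (w : List (ZMod m)) (E : Cn m) (y : ℤ)
    (z : ℤ) (hz : y < RR m hm E z) (hw : (y : ZMod m) ∉ w) : y < RR m hm (PP m w * E) z := by
  induction w with
  | nil => simpa [PP] using hz
  | cons j w ih =>
    simp only [List.mem_cons, not_or] at hw
    have := ih hw.2
    rw [PP_cons, mul_assoc, RR_gmul]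
    generalize RR m hm (PP m w * E) z = t at *
    unfold act
    split_ifs with h
    · by_contra h3
      have : t = y + 1 := by omega
      subst this
      push_cast at h
      exact hw.1 (by grind)
    · exact this

/-- extraction -/
lemma extract {m : ℕ} (hm : 3 ≤ m) (w : List (ZMod m)) (E : Cn m) (i : ZMod m) (hi : i ∈ w)
    (he : ∀ z, ((RR m hm (PP m w * E) z : ℤ) : ZMod m) ≠ i + 1)
    (ho : ∃ z, ((RR m hm (PP m w * E) z : ℤ) : ZMod m) = i) :
    ∃ t : List (ZMod m), t.length < w.length ∧ PP m w * E = gg m i * (PP m t * E) := by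
  have h1 := one_ne hm
  have h2 := two_ne_s14 hm
  induction w with
  | nil => simp at hi
  | cons j w ih =>
    by_cases hji : j = i
    · subst hji
      exact ⟨w, by simp, by rw [PP_cons, mul_assoc]⟩
    have hiw : i ∈ w := by
      rcases List.mem_cons.1 hi with h | h
      · exact absurd h.symm hji
      · exact h
    rw [PP_cons, mul_assoc] at he ho ⊢
    by_cases htr : ∀ z, ((RR m hm (PP m w * E) z : ℤ) : ZMod m) ≠ j + 1
    · have e := claim1 hm _ j htr
      rw [e] at he ho ⊢
      obtain ⟨t, ht, h⟩ := ih hiw he ho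
      exact ⟨t, by simp; omega, h⟩
    push Not at htr
    obtain ⟨z0, hz0⟩ := htr
    simp only [RR_gmul] at he ho
    have hj1 : j ≠ i + 1 := by
      intro h
      apply he z0
      rw [act, if_pos hz0]; push_cast; rw [hz0, h]; ring
    have hj2 : i ≠ j + 1 := by
      intro h
      obtain ⟨z, hz⟩ := ho
      unfold act at hz
      split_ifs at hz with hc
      · push_cast at hz; grind
      · grind
    obtain ⟨t, ht, h⟩ := ih hiw (by
      intro z hz
      apply he z
      rw [act, if_neg (by rw [hz]; grind), hz]) (by
      obtain ⟨z, hz⟩ := ho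
      refine ⟨z, ?_⟩
      unfold act at hz
      split_ifs at hz with hc
      · push_cast at hz; grind
      · exact hz)
    refine ⟨j :: t, by simp; omega, ?_⟩
    rw [h, PP_cons, ← mul_assoc, gg_comm j i hj2 hj1]
    simp only [mul_assoc]

lemma undo {m : ℕ} (hm : 3 ≤ m) (E U : Cn m) (i : ZMod m)
    (hk : ∀ x y, RR m hm (gg m i * (U * E)) x = RR m hm (gg m i * (U * E)) y → RR m hm E x = RR m hm E y)
    (hocc : ∃ z, ((RR m hm (U * E) z : ℤ) : ZMod m) = i + 1) (x : ℤ) :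
    RR m hm (U * E) x = if ((RR m hm (gg m i * (U * E)) x : ℤ) : ZMod m) = i then
      RR m hm (gg m i * (U * E)) x + 1 else RR m hm (gg m i * (U * E)) x := by
  have h1 := one_ne hm
  obtain ⟨z, hz⟩ := hocc
  simp only [RR_gmul] at hk ⊢
  by_cases hx : ((RR m hm (U * E) x : ℤ) : ZMod m) = i + 1
  · rw [act, if_pos hx, if_pos (by push_cast; rw [hx]; ring)]; ring
  · have ha : act m i (RR m hm (U * E) x) = RR m hm (U * E) x := by rw [act, if_neg hx]
    rw [ha]
    by_cases hxi : ((RR m hm (U * E) x : ℤ) : ZMod m) = i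
    · exfalso
      have : ((RR m hm (U * E) x + 1 - RR m hm (U * E) z : ℤ) : ZMod m) = 0 := by
        push_cast; rw [hxi, hz]; ring
      rw [ZMod.intCast_zmod_eq_zero_iff_dvd] at this
      obtain ⟨k, hkk⟩ := this
      have hz' := RR_per hm (U * E) z k
      have e : RR m hm (U * E) (z + m * k) = RR m hm (U * E) x + 1 := by rw [hz']; linarith
      have := hk x (z + m * k) (by
        rw [ha, e, act, if_pos (by push_cast; rw [hxi])]; ring)
      have e3 := RR_mul hm U E x
      rw [this, ← RR_mul] at e3
      omega
    · rw [if_neg hxi]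

lemma main_S {m : ℕ} (hm : 3 ≤ m) (E : Cn m) : ∀ (N : ℕ) (w w' : List (ZMod m)),
    w.length + w'.length ≤ N →
    RR m hm (PP m w * E) = RR m hm (PP m w' * E) →
    (∀ x y, RR m hm (PP m w * E) x = RR m hm (PP m w * E) y → RR m hm E x = RR m hm E y) →
    PP m w * E = PP m w' * E := by
  have h1 := one_ne hm
  intro N
  induction N with
  | zero =>
    intro w w' h _ _
    have h3 : w = [] := List.length_eq_zero_iff.1 (by omega)
    have h4 : w' = [] := List.length_eq_zero_iff.1 (by omega)
    rw [h3, h4]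
  | succ N ih =>
    -- the case of a nonempty first word
    have key : ∀ (i : ZMod m) (u w' : List (ZMod m)), (i :: u).length + w'.length ≤ N + 1 →
        RR m hm (PP m (i :: u) * E) = RR m hm (PP m w' * E) →
        (∀ x y, RR m hm (PP m (i :: u) * E) x = RR m hm (PP m (i :: u) * E) y →
          RR m hm E x = RR m hm E y) →
        PP m (i :: u) * E = PP m w' * E := by
      intro i u w' hl hR hk
      rw [List.length_cons] at hl
      have hl0 := hl
      by_cases htr : ∀ z, ((RR m hm (PP m u * E) z : ℤ) : ZMod m) ≠ i + 1
      · have e := claim1 hm _ i htr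
        rw [PP_cons, mul_assoc, e] at hR hk ⊢
        exact ih u w' (by omega) hR hk
      push Not at htr
      have hocc := htr
      obtain ⟨z0, hz0⟩ := htr
      have hRx : ∀ x, act m i (RR m hm (PP m u * E) x) = RR m hm (PP m w' * E) x := by
        intro x; rw [← hR, PP_cons, mul_assoc, RR_gmul]
      have hw0 := hRx z0
      rw [act, if_pos hz0] at hw0
      have hiw : i ∈ w' := by
        by_contra hcon
        have := RR_no hm w' E (RR m hm (PP m u * E) z0 - 1) z0 (by
          have := RR_le hm (PP m u) (RR m hm E z0)
          rw [RR_mul]; omega) (by push_cast; rw [hz0]; simpa using hcon)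
        omega
      obtain ⟨t, ht, hwt⟩ := extract hm w' E i hiw (by
        intro z hz
        rw [← hRx z] at hz
        unfold act at hz
        split_ifs at hz with hc
        · push_cast at hz; grind
        · exact hc hz) ⟨z0, by rw [← hw0]; push_cast; rw [hz0]; ring⟩
      by_cases htr : ∀ z, ((RR m hm (PP m t * E) z : ℤ) : ZMod m) ≠ i + 1
      · have e := claim1 hm _ i htr
        rw [hwt, e] at hR ⊢
        exact ih (i :: u) t (by simp; omega) hR hk
      push Not at htr
      have hRt : RR m hm (gg m i * (PP m u * E)) = RR m hm (gg m i * (PP m t * E)) := by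
        rw [← hwt, ← hR, PP_cons, mul_assoc]
      rw [PP_cons, mul_assoc] at hk ⊢
      rw [hwt]
      congr 1
      apply ih u t (by omega)
      · funext x
        rw [undo hm E _ i hk hocc, undo hm E _ i (by rw [← hRt]; exact hk) htr, hRt]
      · intro x y hxy
        apply hk
        rw [RR_gmul, RR_gmul, hxy]
    intro w w' hl hR hk
    rcases w with _ | ⟨i, u⟩
    · rcases w' with _ | ⟨i, u⟩
      · rfl
      · exact (key i u [] (by simpa using hl) hR.symm (by rw [← hR]; exact hk)).symm
    · exact key i u w' hl hR hk

theorem faithful {m : ℕ} (hm : 3 ≤ m) : Function.Injective (RR m hm) := by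
  intro c d hcd
  let S : Set (Cn m) := {E | c * E = c ∧ d * E = d}
  let μ : Cn m → ℕ := fun E => ∑ x ∈ Finset.range m, (RR m hm E x - RR m hm c x).toNat
  have hne : S.Nonempty := ⟨1, by simp [S]⟩
  obtain ⟨E, hE, hmin⟩ : ∃ E ∈ S, ∀ F ∈ S, μ E ≤ μ F := by
    obtain ⟨E, hE, h⟩ := (measure μ).wf.has_min S hne
    exact ⟨E, hE, fun F hF => not_lt.1 (h F hF)⟩
  have hlow : ∀ F ∈ S, ∀ x, RR m hm c x ≤ RR m hm F x := by
    intro F hF x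
    conv_lhs => rw [← hF.1, RR_mul]
    exact RR_le hm _ _
  have key : ∀ x y, RR m hm c x = RR m hm c y → ¬ RR m hm E x < RR m hm E y := by
    intro x y hxy hlt
    have hcx : RR m hm c (RR m hm E x) = RR m hm c (RR m hm E y) := by
      rw [← RR_mul, ← RR_mul, hE.1, hxy]
    set p := RR m hm E y - 1 with hp
    have a1 := RR_mono hm c (show RR m hm E x ≤ p by omega)
    have a2 := RR_mono hm c (show p ≤ p + 1 by omega)
    have a3 : p + 1 = RR m hm E y := by omega
    have hcp : RR m hm c p = RR m hm c (p + 1) := by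
      rw [a3] at a2 ⊢; omega
    have e1 := claim2 hm c p hcp
    have e2 := claim2 hm d p (by rw [← hcd]; exact hcp)
    have hF : gg m p * E ∈ S := ⟨by rw [← mul_assoc, e1, hE.1], by rw [← mul_assoc, e2, hE.2]⟩
    have := hmin _ hF
    apply absurd this
    rw [not_le]
    have hm0 : (0 : ℤ) < m := by omega
    have hy0 := Int.emod_nonneg y hm0.ne'
    have hy1 := Int.emod_lt_of_pos y hm0
    have hyy := Int.emod_add_mul_ediv y m
    apply Finset.sum_lt_sum
    · intro x _
      have := act_le (p : ZMod m) (RR m hm E x)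
      rw [RR_gmul]
      omega
    · refine ⟨(y % m).toNat, by rw [Finset.mem_range]; omega, ?_⟩
      rw [Int.toNat_of_nonneg hy0]
      have l := hlow _ hF (y % m)
      rw [RR_gmul] at l ⊢
      have hper := RR_per hm E (y % m) (y / m)
      rw [hyy] at hper
      have : ((RR m hm E (y % m) : ℤ) : ZMod m) = (p : ZMod m) + 1 := by
        have : p = RR m hm E (y % m) + m * (y / m) - 1 := by omega
        rw [this]; push_cast; simp
      rw [act, if_pos this] at l ⊢
      omega
  obtain ⟨w, rfl⟩ := exists_PP c
  obtain ⟨w', rfl⟩ := exists_PP d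
  rw [← hE.1, ← hE.2]
  apply main_S hm E _ w w' le_rfl
  · rw [hE.1, hE.2, hcd]
  · rw [hE.1]
    intro x y hxy
    have := key x y hxy
    have := key y x hxy.symm
    omega

lemma act_eval {m : ℕ} (hm : 3 ≤ m) (k : ℕ) (hk : k < m) (q r : ℤ) (h0 : 0 ≤ r) (h1 : r < m) :
    act m (k : ZMod m) (m * q + r) =
      if r = k + 1 ∨ (r = 0 ∧ k + 1 = m) then m * q + r - 1 else m * q + r := by
  have key : (((m * q + r : ℤ) : ZMod m) = (k : ZMod m) + 1) ↔ (r = k + 1 ∨ (r = 0 ∧ k + 1 = m)) := by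
    have : (((m * q + r : ℤ) : ZMod m) = (k : ZMod m) + 1) ↔ (m : ℤ) ∣ r - k - 1 := by
      rw [← ZMod.intCast_zmod_eq_zero_iff_dvd]
      push_cast
      simp only [CharP.cast_eq_zero, zero_mul, zero_add]
      constructor
      · intro h; rw [h]; ring
      · intro h; linear_combination h
    rw [this]
    constructor
    · intro h
      by_cases hneg : r - k - 1 < 0
      · right
        have h2 : (m : ℤ) ∣ r - k - 1 + m := Dvd.dvd.add h (dvd_refl _)
        by_contra hc
        have := Int.le_of_dvd (by omega) h2
        omega
      · left
        by_contra hc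
        have := Int.le_of_dvd (by omega) h
        omega
    · rintro (h | ⟨h, h'⟩)
      · rw [h]; ring_nf; simp
      · rw [h, ← h']; push_cast; exact ⟨-1, by ring⟩
  unfold act
  simp only [key]

def th (m : ℕ) (s : ℤ) : ℤ := (m + 1) * (s / m) + (if s % m = 0 then 0 else s % m + 1)

lemma th_eval {m : ℕ} (q r : ℤ) (h0 : 0 ≤ r) (h1 : r < m) :
    th m (m * q + r) = (m + 1) * q + (if r = 0 then 0 else r + 1) := by
  have a : (m * q + r) % m = r := by rw [Int.mul_add_emod_self_left, Int.emod_eq_of_lt h0 h1]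
  have b : (m * q + r) / m = q := by
    rw [Int.mul_add_ediv_left _ _ (by omega), Int.ediv_eq_zero_of_lt h0 h1, add_zero]
  rw [th, a, b]

lemma th_inj {m : ℕ} (hm : 3 ≤ m) : Function.Injective (th m) := by
  intro s t h
  have hm0 : (0 : ℤ) < m := by omega
  have s0 := Int.emod_nonneg s hm0.ne'
  have s1 := Int.emod_lt_of_pos s hm0
  have t0 := Int.emod_nonneg t hm0.ne'
  have t1 := Int.emod_lt_of_pos t hm0
  have hs := Int.emod_add_mul_ediv s m
  have ht := Int.emod_add_mul_ediv t m
  unfold th at h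
  set a := s % m
  set b := t % m
  set q := s / m
  set p := t / m
  have hq : q = p := by
    have h3 : ((m : ℤ) + 1) * (q - p) = (if b = 0 then 0 else b + 1) - (if a = 0 then 0 else a + 1) := by
      linear_combination h
    have h4 : ((m : ℤ) + 1) * (q - p) < (m + 1) * 1 := by rw [h3]; split_ifs <;> omega
    have h5 : ((m : ℤ) + 1) * (-1) < (m + 1) * (q - p) := by rw [h3]; split_ifs <;> omega
    have h6 := lt_of_mul_lt_mul_left h4 (by omega)
    have h7 := lt_of_mul_lt_mul_left h5 (by omega)
    omega
  rw [hq] at h hs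
  have : a = b := by
    have := add_left_cancel h
    split_ifs at this <;> omega
  rw [← hs, ← ht, this]

def G (m k : ℕ) : Cn m := gg m (k : ZMod m)

lemma cast_ne {m k l : ℕ} (hk : k < m) (hl : l < m) (h : k ≠ l) : (k : ZMod m) ≠ (l : ZMod m) := by
  intro e
  rw [ZMod.natCast_eq_natCast_iff', Nat.mod_eq_of_lt hk, Nat.mod_eq_of_lt hl] at e
  exact h e

lemma G_ne {m k l : ℕ} (hm : 3 ≤ m) (hk : k < m) (hl : l < m) (h1 : l ≠ k + 1)
    (h2 : ¬ (l = 0 ∧ k + 1 = m)) : (l : ZMod m) ≠ (k : ZMod m) + 1 := by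
  by_cases h : k + 1 < m
  · have := cast_ne hl h h1
    push_cast at this
    exact this
  · have hkm : k + 1 = m := by omega
    have h3 : (k : ZMod m) + 1 = ((0 : ℕ) : ZMod m) := by
      have : ((k + 1 : ℕ) : ZMod m) = 0 := by rw [hkm]; simp
      push_cast at this ⊢
      exact this
    rw [h3]
    exact cast_ne hl (by omega) (by omega)

lemma G_comm {m k l : ℕ} (hm : 3 ≤ m) (hk : k < m) (hl : l < m) (h1 : l ≠ k + 1) (h2 : k ≠ l + 1)
    (h3 : ¬ (l = 0 ∧ k + 1 = m)) (h4 : ¬ (k = 0 ∧ l + 1 = m)) : G m k * G m l = G m l * G m k :=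
  gg_comm _ _ (G_ne hm hk hl h1 h3) (G_ne hm hl hk h2 h4)

def psi (m : ℕ) (a : ZMod m) : Cn (m + 1) :=
  if a = 0 then G (m + 1) 0 * G (m + 1) 1 else G (m + 1) (a.val + 1)

lemma psi_zero (m : ℕ) : psi m 0 = G (m + 1) 0 * G (m + 1) 1 := by simp [psi]

lemma psi_pos {m k : ℕ} (h0 : 1 ≤ k) (hk : k < m) : psi m (k : ZMod m) = G (m + 1) (k + 1) := by
  rw [psi, if_neg, ZMod.val_natCast, Nat.mod_eq_of_lt hk]
  have := cast_ne hk (show 0 < m by omega) (by omega)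
  simpa using this

lemma psi_rel {m : ℕ} (hm : 3 ≤ m) (u v : FreeMonoid (ZMod m)) (h : cnRel m u v) :
    FreeMonoid.lift (psi m) u = FreeMonoid.lift (psi m) v := by
  have hM : 3 ≤ m + 1 := by omega
  have : NeZero m := ⟨by omega⟩
  have sq : ∀ k, G (m + 1) k * G (m + 1) k = G (m + 1) k := fun k => gg_sq _
  have aba : ∀ k, G (m + 1) k * G (m + 1) (k + 1) * G (m + 1) k = G (m + 1) k * G (m + 1) (k + 1) :=
    fun k => gg_aba _ _ (by push_cast; rfl)
  have bab : ∀ k, G (m + 1) (k + 1) * G (m + 1) k * G (m + 1) (k + 1) =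
      G (m + 1) k * G (m + 1) (k + 1) :=
    fun k => gg_bab _ _ (by push_cast; rfl)
  have z0 : ((0 : ℕ) : ZMod (m + 1)) = (m : ZMod (m + 1)) + 1 := by
    have : ((m + 1 : ℕ) : ZMod (m + 1)) = 0 := ZMod.natCast_self _
    push_cast at this ⊢
    exact this.symm
  have aba0 : G (m + 1) m * G (m + 1) 0 * G (m + 1) m = G (m + 1) m * G (m + 1) 0 := gg_aba _ _ z0
  have bab0 : G (m + 1) 0 * G (m + 1) m * G (m + 1) 0 = G (m + 1) m * G (m + 1) 0 := gg_bab _ _ z0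
  have c02 : G (m + 1) 0 * G (m + 1) 2 = G (m + 1) 2 * G (m + 1) 0 :=
    G_comm hM (by omega) (by omega) (by omega) (by omega) (by omega) (by omega)
  have c1m : G (m + 1) 1 * G (m + 1) m = G (m + 1) m * G (m + 1) 1 :=
    G_comm hM (by omega) (by omega) (by omega) (by omega) (by omega) (by omega)
  have a01 := aba 0
  have b01 := bab 0
  have a12 := aba 1
  have b12 := bab 1
  simp only [zero_add, one_add_one_eq_two] at a01 b01 a12 b12
  have cX : ∀ l, 1 ≤ l → l < m → l ≠ 1 → l + 1 ≠ m →
      G (m + 1) 0 * G (m + 1) 1 * G (m + 1) (l + 1) = G (m + 1) (l + 1) * (G (m + 1) 0 * G (m + 1) 1) := by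
    intro l h1 h2 h3 h4
    rw [mul_assoc, G_comm hM (k := 1) (l := l + 1) (by omega) (by omega) (by omega) (by omega)
      (by omega) (by omega), ← mul_assoc, G_comm hM (k := 0) (l := l + 1) (by omega) (by omega)
      (by omega) (by omega) (by omega) (by omega), mul_assoc]
  have ex : ∀ a : ZMod m, ∃ k : ℕ, k < m ∧ (k : ZMod m) = a := fun a =>
    ⟨a.val, ZMod.val_lt a, ZMod.natCast_zmod_val a⟩
  have cm : ∀ k : ℕ, k + 1 = m → (k : ZMod m) + 1 = 0 := by
    intro k hk
    have : ((k + 1 : ℕ) : ZMod m) = 0 := by rw [hk]; simp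
    push_cast at this
    exact this
  rcases h with ⟨a, rfl, rfl⟩ | ⟨a, b, hab, hba, rfl, rfl⟩ | ⟨a, h, rfl⟩
  · simp only [map_mul, FreeMonoid.lift_eval_of]
    unfold psi
    split_ifs
    · rw [← mul_assoc, a01, mul_assoc, sq]
    · exact sq _
  · simp only [map_mul, FreeMonoid.lift_eval_of]
    obtain ⟨k, hk, rfl⟩ := ex a
    obtain ⟨l, hl, rfl⟩ := ex b
    have n1 : l ≠ k + 1 := by rintro rfl; exact hab (by push_cast; rfl)
    have n2 : k ≠ l + 1 := by rintro rfl; exact hba (by push_cast; rfl)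
    have n3 : ¬ (l = 0 ∧ k + 1 = m) := by
      rintro ⟨rfl, h⟩; exact hab (by rw [cm k h]; simp)
    have n4 : ¬ (k = 0 ∧ l + 1 = m) := by
      rintro ⟨rfl, h⟩; exact hba (by rw [cm l h]; simp)
    rcases Nat.eq_zero_or_pos k with rfl | hk0
    · rcases Nat.eq_zero_or_pos l with rfl | hl0
      · rfl
      · rw [psi_pos hl0 hl, Nat.cast_zero, psi_zero]
        exact cX l hl0 hl (by omega) (by omega)
    · rcases Nat.eq_zero_or_pos l with rfl | hl0
      · rw [psi_pos hk0 hk, Nat.cast_zero, psi_zero]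
        exact (cX k hk0 hk (by omega) (by omega)).symm
      · rw [psi_pos hk0 hk, psi_pos hl0 hl]
        exact G_comm hM (by omega) (by omega) (by omega) (by omega) (by omega) (by omega)
  · suffices hh : psi m a * psi m (a + 1) * psi m a = psi m a * psi m (a + 1) ∧
        psi m (a + 1) * psi m a * psi m (a + 1) = psi m a * psi m (a + 1) by
      rcases h with rfl | rfl
      · simpa only [map_mul, FreeMonoid.lift_eval_of] using hh.1
      · simpa only [map_mul, FreeMonoid.lift_eval_of] using hh.2
    obtain ⟨k, hk, rfl⟩ := ex a
    rcases Nat.eq_zero_or_pos k with rfl | hk0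
    · have : psi m (((0 : ℕ) : ZMod m) + 1) = G (m + 1) 2 := by
        have := psi_pos (m := m) (k := 1) le_rfl (by omega)
        simpa using this
      rw [this, Nat.cast_zero, psi_zero]
      generalize G (m + 1) 0 = x0 at *
      generalize G (m + 1) 1 = x1 at *
      generalize G (m + 1) 2 = x2 at *
      constructor
      · calc x0 * x1 * x2 * (x0 * x1) = x0 * x1 * (x2 * x0) * x1 := by simp only [mul_assoc]
          _ = (x0 * x1 * x0) * x2 * x1 := by rw [← c02]; simp only [mul_assoc]
          _ = x0 * (x1 * x2 * x1) := by rw [a01]; simp only [mul_assoc]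
          _ = x0 * x1 * x2 := by rw [a12]; simp only [mul_assoc]
      · calc x2 * (x0 * x1) * x2 = (x2 * x0) * x1 * x2 := by simp only [mul_assoc]
          _ = x0 * (x2 * x1 * x2) := by rw [← c02]; simp only [mul_assoc]
          _ = x0 * x1 * x2 := by rw [b12]; simp only [mul_assoc]
    · by_cases hkm : k + 1 = m
      · rw [cm k hkm, psi_zero, psi_pos hk0 hk, hkm]
        generalize G (m + 1) 0 = x0 at *
        generalize G (m + 1) 1 = x1 at *
        generalize G (m + 1) m = y at *
        constructor
        · calc y * (x0 * x1) * y = y * x0 * (x1 * y) := by simp only [mul_assoc]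
            _ = (y * x0 * y) * x1 := by rw [c1m]; simp only [mul_assoc]
            _ = y * (x0 * x1) := by rw [aba0]; simp only [mul_assoc]
        · calc x0 * x1 * y * (x0 * x1) = x0 * (x1 * y) * x0 * x1 := by simp only [mul_assoc]
            _ = x0 * y * (x1 * x0 * x1) := by rw [c1m]; simp only [mul_assoc]
            _ = (x0 * y * x0) * x1 := by rw [b01]; simp only [mul_assoc]
            _ = y * (x0 * x1) := by rw [bab0]; simp only [mul_assoc]
      · have e : psi m ((k : ZMod m) + 1) = G (m + 1) (k + 1 + 1) := by
          have := psi_pos (m := m) (k := k + 1) (by omega) (by omega)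
          push_cast at this
          exact this
        rw [e, psi_pos hk0 hk]
        exact ⟨aba _, bab _⟩

def phi (m : ℕ) (hm : 3 ≤ m) : Cn m →* Cn (m + 1) :=
  Con.lift _ (FreeMonoid.lift (psi m)) (Con.conGen_le.2 fun u v h => psi_rel hm u v h)

lemma phi_gg {m : ℕ} (hm : 3 ≤ m) (a : ZMod m) : phi m hm (gg m a) = psi m a := by
  rfl

lemma equiv_gen {m : ℕ} (hm : 3 ≤ m) (hM : 3 ≤ m + 1) (a : ZMod m) (s : ℤ) :
    RR (m + 1) hM (psi m a) (th m s) = th m (act m a s) := by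
  have : NeZero m := ⟨by omega⟩
  obtain ⟨k, hk, rfl⟩ : ∃ k : ℕ, k < m ∧ (k : ZMod m) = a :=
    ⟨a.val, ZMod.val_lt a, ZMod.natCast_zmod_val a⟩
  have hm0 : (0 : ℤ) < m := by omega
  have s0 := Int.emod_nonneg s hm0.ne'
  have s1 := Int.emod_lt_of_pos s hm0
  have hs := Int.mul_ediv_add_emod s m
  generalize s / m = q at *
  generalize s % m = r at *
  subst hs
  rw [act_eval hm k hk q r s0 s1]
  have th1 := th_eval (m := m) q r s0 s1
  have ev : ∀ (j : ℕ) (p t : ℤ), j < m + 1 → 0 ≤ t → t < m + 1 →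
      RR (m + 1) hM (G (m + 1) j) ((m + 1) * p + t) =
      if t = j + 1 ∨ (t = 0 ∧ j + 1 = m + 1) then (m + 1) * p + t - 1 else (m + 1) * p + t := by
    intro j p t hj h0 h1
    rw [G, RR_gg]
    have := act_eval hM j hj p t h0 (by push_cast; exact h1)
    rw [Nat.cast_add, Nat.cast_one] at this
    exact this
  rcases Nat.eq_zero_or_pos k with rfl | hk0
  · rw [Nat.cast_zero, psi_zero, RR_mul, th1]
    have e1 := ev 1 q (if r = 0 then 0 else r + 1) (by omega) (by split_ifs <;> omega)
      (by split_ifs <;> omega)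
    rw [e1]
    by_cases hr : r = 1
    · subst hr
      have e2 := ev 0 q 1 (by omega) (by omega) (by omega)
      have th2 := th_eval (m := m) q 0 (by omega) (by omega)
      norm_num at e2 th2 ⊢
      rw [show ((m : ℤ) + 1) * q + 2 - 1 = (m + 1) * q + 1 by ring, e2, th2]
    · have e2 := ev 0 q (if r = 0 then 0 else r + 1) (by omega) (by split_ifs <;> omega)
        (by split_ifs <;> omega)
      have n3 : ¬ (r = ((0 : ℕ) : ℤ) + 1 ∨ r = 0 ∧ 0 + 1 = m) := by omega
      rw [if_neg n3, th1, if_neg (by push_cast; split_ifs <;> omega), e2,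
        if_neg (by push_cast; split_ifs <;> omega)]
  · rw [psi_pos hk0 hk, th1]
    rw [ev (k + 1) q (if r = 0 then 0 else r + 1) (by omega) (by split_ifs <;> omega)
      (by split_ifs <;> omega)]
    by_cases h1 : r = k + 1
    · have th2 := th_eval (m := m) q k (by omega) (by omega)
      rw [if_pos (Or.inl (by push_cast; split_ifs <;> omega)), if_pos (Or.inl h1), h1,
        if_neg (by omega), show (m : ℤ) * q + (k + 1) - 1 = m * q + k by ring, th2,
        if_neg (by omega)]
      ring
    · by_cases h2 : r = 0 ∧ k + 1 = m
      · have th2 := th_eval (m := m) (q - 1) (m - 1) (by omega) (by omega)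
        rw [if_pos (Or.inr (by push_cast; split_ifs <;> omega)), if_pos (Or.inr h2), h2.1, if_pos rfl,
          show (m : ℤ) * q + 0 - 1 = m * (q - 1) + (m - 1) by ring, th2, if_neg (by omega)]
        ring
      · have n3 : ¬ (r = (k : ℤ) + 1 ∨ r = 0 ∧ k + 1 = m) := by omega
        rw [if_neg n3, th1, if_neg (by push_cast; split_ifs <;> omega)]

lemma equiv_all {m : ℕ} (hm : 3 ≤ m) (hM : 3 ≤ m + 1) (c : Cn m) :
    ∀ s, RR (m + 1) hM (phi m hm c) (th m s) = th m (RR m hm c s) := by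
  induction c using Cn_ind with
  | h1 => intro s; rw [map_one, RR_one, RR_one]
  | hg i c ih => intro s; rw [map_mul, RR_mul, ih, phi_gg, equiv_gen hm, RR_gmul]

lemma phi_inj {m : ℕ} (hm : 3 ≤ m) : Function.Injective (phi m hm) := by
  intro c d h
  have hM : 3 ≤ m + 1 := by omega
  apply faithful hm
  funext s
  apply th_inj hm
  rw [← equiv_all hm hM, ← equiv_all hm hM, h]

theorem aux (m : ℕ) (hm : 3 ≤ m) :
    ∃ φ : Cn m →* Cn (m + 1),
      Function.Injective φ ∧
      (∀ i : ℕ, 1 ≤ i → i ≤ m - 1 →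
        φ (pr m (fx m i)) = pr (m + 1) (fx (m + 1) (i + 1))) ∧
      φ (pr m (fx m m)) = pr (m + 1) (fx (m + 1) (m + 1) * fx (m + 1) 1) ∧
      Set.range φ = ↑(Submonoid.closure
        ({g : Cn (m + 1) | ∃ i : ℕ, 2 ≤ i ∧ i ≤ m ∧ g = pr (m + 1) (fx (m + 1) i)} ∪
          {pr (m + 1) (fx (m + 1) (m + 1) * fx (m + 1) 1)})) := by
  have hg : ∀ i : ℕ, 1 ≤ i → i ≤ m - 1 →
        phi m hm (pr m (fx m i)) = pr (m + 1) (fx (m + 1) (i + 1)) := fun i h1 h2 =>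
    psi_pos h1 (by omega)
  have hl : phi m hm (pr m (fx m m)) = pr (m + 1) (fx (m + 1) (m + 1) * fx (m + 1) 1) := by
    have e : phi m hm (pr m (fx m m)) = psi m (m : ZMod m) := rfl
    have e2 : fx (m + 1) (m + 1) = FreeMonoid.of (((0 : ℕ) : ZMod (m + 1))) := by
      rw [fx, ZMod.natCast_self, Nat.cast_zero]
    rw [e, ZMod.natCast_self, psi_zero, map_mul, e2]
    rfl
  refine ⟨phi m hm, phi_inj hm, hg, hl, ?_⟩
  have : NeZero m := ⟨by omega⟩
  apply Set.Subset.antisymm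
  · rintro _ ⟨c, rfl⟩
    induction c using Cn_ind with
    | h1 => rw [map_one]; exact Submonoid.one_mem _
    | hg a c ih =>
      rw [map_mul (phi m hm)]
      refine Submonoid.mul_mem _ (Submonoid.subset_closure ?_) ih
      obtain ⟨k, hk, rfl⟩ : ∃ k : ℕ, k < m ∧ (k : ZMod m) = a :=
        ⟨a.val, ZMod.val_lt a, ZMod.natCast_zmod_val a⟩
      rcases Nat.eq_zero_or_pos k with rfl | hk0
      · right
        rw [Set.mem_singleton_iff, ← hl, Nat.cast_zero, ← ZMod.natCast_self m]
        rfl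
      · left
        exact ⟨k + 1, by omega, by omega, hg k hk0 (by omega)⟩
  · rw [← MonoidHom.coe_mrange, SetLike.coe_subset_coe, Submonoid.closure_le]
    rintro g (⟨i, h1, h2, rfl⟩ | rfl)
    · refine ⟨pr m (fx m (i - 1)), ?_⟩
      rw [hg (i - 1) (by omega) (by omega), Nat.sub_add_cancel (by omega)]
    · exact ⟨_, hl⟩

/-- Lemma 5.2 (induction): `C_{n-1}` embeds in `C_n` via
`y_i ↦ x_{i+1}` (`1 ≤ i ≤ n-2`), `y_{n-1} ↦ x_n x_1`, with image the
submonoid generated by `x_2, …, x_{n-1}, x_n x_1`. -/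
theorem stmt14 (n : ℕ) (hn : 4 ≤ n) :
    ∃ φ : Cn (n - 1) →* Cn n,
      Function.Injective φ ∧
      (∀ i : ℕ, 1 ≤ i → i ≤ n - 2 →
        φ (pr (n - 1) (fx (n - 1) i)) = pr n (fx n (i + 1))) ∧
      φ (pr (n - 1) (fx (n - 1) (n - 1))) = pr n (fx n n * fx n 1) ∧
      Set.range φ = ↑(Submonoid.closure
        ({g : Cn n | ∃ i : ℕ, 2 ≤ i ∧ i ≤ n - 1 ∧ g = pr n (fx n i)} ∪
          {pr n (fx n n * fx n 1)})) := by
  obtain ⟨m, rfl⟩ : ∃ m, n = m + 1 := ⟨n - 1, by omega⟩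
  exact aux m (by omega)

end HK
end
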